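/- Let C be a nondegenerate closed axis-parallel rectangle in ℝ², let m ≥ 1, and let Z₁, …, Zₘ be pairwise interior-disjoint nondegenerate closed axis-parallel rectangles contained in C forming a maximal arrangement: for every i and every nondegenerate closed axis-parallel rectangle R with Zᵢ ⊆ R ⊆ C whose interior is disjoint from interior(Zⱼ) for all j ≠ i, one has R = Zᵢ. Then the set of connected components of interior(C) \ (Z₁ ∪ ⋯ ∪ Zₘ) is finite and has at most m − ⌈2√m − 1⌉ elements. -/

import Mathlib

/-- A nondegenerate closed axis-parallel rectangle in ℝ²:
a set of the form [a, b] × [c, d] with a < b and c < d. -/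
def IsRect (S : Set (ℝ × ℝ)) : Prop :=
  ∃ a b c d : ℝ, a < b ∧ c < d ∧ S = Set.Icc a b ×ˢ Set.Icc c d

/-- A finite arrangement of rectangles together with a frame `C`; the rectangles
include four outer walls, so that every side facing `C` is blocked. -/
structure Arr (ι : Type) where
  l : ι → ℝ
  r : ι → ℝ
  b : ι → ℝ
  t : ι → ℝ
  cl : ℝ
  cr : ℝ
  cb : ℝ
  ct : ℝ
  hlr : ∀ i, l i < r i
  hbt : ∀ i, b i < t i
  disj : ∀ i j, i ≠ j → r i ≤ l j ∨ r j ≤ l i ∨ t i ≤ b j ∨ t j ≤ b i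
  blkR : ∀ i, r i < cr → ∃ j, l j = r i ∧ b j < t i ∧ b i < t j
  blkL : ∀ i, cl < l i → ∃ j, r j = l i ∧ b j < t i ∧ b i < t j
  blkT : ∀ i, t i < ct → ∃ j, b j = t i ∧ l j < r i ∧ l i < r j
  blkB : ∀ i, cb < b i → ∃ j, t j = b i ∧ l j < r i ∧ l i < r j
  wallL : ∃ i, r i = cl ∧ b i ≤ cb ∧ ct ≤ t i
  wallR : ∃ i, l i = cr ∧ b i ≤ cb ∧ ct ≤ t i
  wallB : ∃ i, t i = cb ∧ l i ≤ cl ∧ cr ≤ r i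
  wallT : ∃ i, b i = ct ∧ l i ≤ cl ∧ cr ≤ r i

namespace Arr

variable {ι : Type}

/-- Rotation by a quarter turn: `(x, y) ↦ (y, -x)`. -/
def rot (A : Arr ι) : Arr ι where
  l := A.b
  r := A.t
  b := fun i => -A.r i
  t := fun i => -A.l i
  cl := A.cb
  cr := A.ct
  cb := -A.cr
  ct := -A.cl
  hlr := A.hbt
  hbt := fun i => neg_lt_neg (A.hlr i)
  disj := fun i j h => by
    rcases A.disj i j h with h | h | h | h
    · right; right; right; linarith
    · right; right; left; linarith
    · left; linarith
    · right; left; linarith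
  blkR := fun i h => by
    obtain ⟨j, h1, h2, h3⟩ := A.blkT i h
    exact ⟨j, h1, by linarith, by linarith⟩
  blkL := fun i h => by
    obtain ⟨j, h1, h2, h3⟩ := A.blkB i h
    exact ⟨j, h1, by linarith, by linarith⟩
  blkT := fun i h => by
    obtain ⟨j, h1, h2, h3⟩ := A.blkL i (by linarith)
    exact ⟨j, by linarith, by linarith, by linarith⟩
  blkB := fun i h => by
    obtain ⟨j, h1, h2, h3⟩ := A.blkR i (by linarith)
    exact ⟨j, by linarith, by linarith, by linarith⟩
  wallL := by
    obtain ⟨j, h1, h2, h3⟩ := A.wallB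
    exact ⟨j, by linarith, by linarith, by linarith⟩
  wallR := by
    obtain ⟨j, h1, h2, h3⟩ := A.wallT
    exact ⟨j, by linarith, by linarith, by linarith⟩
  wallB := by
    obtain ⟨j, h1, h2, h3⟩ := A.wallR
    exact ⟨j, by linarith, by linarith, by linarith⟩
  wallT := by
    obtain ⟨j, h1, h2, h3⟩ := A.wallL
    exact ⟨j, by linarith, by linarith, by linarith⟩

/-- Reflection `(x, y) ↦ (-x, y)`. -/
def flip (A : Arr ι) : Arr ι where
  l := fun i => -A.r i
  r := fun i => -A.l i
  b := A.b
  t := A.t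
  cl := -A.cr
  cr := -A.cl
  cb := A.cb
  ct := A.ct
  hlr := fun i => neg_lt_neg (A.hlr i)
  hbt := A.hbt
  disj := fun i j h => by
    rcases A.disj i j h with h | h | h | h
    · right; left; linarith
    · left; linarith
    · right; right; left; linarith
    · right; right; right; linarith
  blkR := fun i h => by
    obtain ⟨j, h1, h2, h3⟩ := A.blkL i (by linarith)
    exact ⟨j, by linarith, by linarith, by linarith⟩
  blkL := fun i h => by
    obtain ⟨j, h1, h2, h3⟩ := A.blkR i (by linarith)
    exact ⟨j, by linarith, by linarith, by linarith⟩
  blkT := fun i h => by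
    obtain ⟨j, h1, h2, h3⟩ := A.blkT i (by linarith)
    exact ⟨j, by linarith, by linarith, by linarith⟩
  blkB := fun i h => by
    obtain ⟨j, h1, h2, h3⟩ := A.blkB i (by linarith)
    exact ⟨j, by linarith, by linarith, by linarith⟩
  wallL := by
    obtain ⟨j, h1, h2, h3⟩ := A.wallR
    exact ⟨j, by linarith, by linarith, by linarith⟩
  wallR := by
    obtain ⟨j, h1, h2, h3⟩ := A.wallL
    exact ⟨j, by linarith, by linarith, by linarith⟩
  wallB := by
    obtain ⟨j, h1, h2, h3⟩ := A.wallB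
    exact ⟨j, by linarith, by linarith, by linarith⟩
  wallT := by
    obtain ⟨j, h1, h2, h3⟩ := A.wallT
    exact ⟨j, by linarith, by linarith, by linarith⟩

/-- Reflection `(x, y) ↦ (-y, -x)`. -/
def anti (A : Arr ι) : Arr ι := A.rot.flip

lemma eq_of_overlap (A : Arr ι) {i j : ι} (h1 : A.l i < A.r j) (h2 : A.l j < A.r i)
    (h3 : A.b i < A.t j) (h4 : A.b j < A.t i) : i = j := by
  by_contra h
  rcases A.disj i j h with h | h | h | h <;> linarith

/-- The open box meets no rectangle. -/
def Empty (A : Arr ι) (x1 x2 y1 y2 : ℝ) : Prop :=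
  ∀ i, x2 ≤ A.l i ∨ A.r i ≤ x1 ∨ y2 ≤ A.b i ∨ A.t i ≤ y1

/-- An empty box in the frame. -/
structure Box (A : Arr ι) (x1 x2 y1 y2 : ℝ) : Prop where
  hx : x1 < x2
  hy : y1 < y2
  cl : A.cl ≤ x1
  cr : x2 ≤ A.cr
  cb : A.cb ≤ y1
  ct : y2 ≤ A.ct
  emp : A.Empty x1 x2 y1 y2

lemma Box.rot {A : Arr ι} {x1 x2 y1 y2 : ℝ} (h : A.Box x1 x2 y1 y2) :
    A.rot.Box y1 y2 (-x2) (-x1) where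
  hx := h.hy
  hy := neg_lt_neg h.hx
  cl := h.cb
  cr := h.ct
  cb := neg_le_neg h.cr
  ct := neg_le_neg h.cl
  emp := fun i => by
    rcases h.emp i with h | h | h | h
    · right; right; right; exact neg_le_neg h
    · right; right; left; exact neg_le_neg h
    · left; exact h
    · right; left; exact h

lemma Box.flip {A : Arr ι} {x1 x2 y1 y2 : ℝ} (h : A.Box x1 x2 y1 y2) :
    A.flip.Box (-x2) (-x1) y1 y2 where
  hx := neg_lt_neg h.hx
  hy := h.hy
  cl := neg_le_neg h.cr
  cr := neg_le_neg h.cl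
  cb := h.cb
  ct := h.ct
  emp := fun i => by
    rcases h.emp i with h | h | h | h
    · right; left; exact neg_le_neg h
    · left; exact neg_le_neg h
    · right; right; left; exact h
    · right; right; right; exact h

/-- The box can be extended down until it touches a rectangle. -/
lemma Box.down [Finite ι] {A : Arr ι} {x1 x2 y1 y2 : ℝ} (h : A.Box x1 x2 y1 y2) :
    ∃ y, y ≤ y1 ∧ A.Box x1 x2 y y2 ∧ ∃ D, A.t D = y ∧ A.l D < x2 ∧ x1 < A.r D := by
  classical
  have := Fintype.ofFinite ι
  obtain ⟨w, hw1, hw2, hw3⟩ := A.wallB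
  let S : Finset ι := Finset.univ.filter (fun i => A.t i ≤ y1 ∧ A.l i < x2 ∧ x1 < A.r i)
  have hwS : w ∈ S := by
    simp only [S, Finset.mem_filter, Finset.mem_univ, true_and]
    exact ⟨by linarith [h.cb], by linarith [h.cl, h.hx], by linarith [h.cr, h.hx]⟩
  obtain ⟨D, hD, hmax⟩ := Finset.exists_max_image S A.t ⟨w, hwS⟩
  have hD' := hD
  simp only [S, Finset.mem_filter, Finset.mem_univ, true_and] at hD'
  refine ⟨A.t D, hD'.1, ⟨h.hx, by linarith [h.hy, hD'.1], h.cl, h.cr, ?_, h.ct, ?_⟩, D, rfl, hD'.2⟩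
  · rw [← hw1]; exact hmax w hwS
  · intro i
    rcases h.emp i with h1 | h1 | h1 | h1
    · exact Or.inl h1
    · exact Or.inr (Or.inl h1)
    · exact Or.inr (Or.inr (Or.inl h1))
    · by_cases h2 : A.l i < x2
      · by_cases h3 : x1 < A.r i
        · right; right; right
          apply hmax
          simp only [S, Finset.mem_filter, Finset.mem_univ, true_and]
          exact ⟨h1, h2, h3⟩
        · right; left; linarith
      · left; linarith

lemma Box.left [Finite ι] {A : Arr ι} {x1 x2 y1 y2 : ℝ} (h : A.Box x1 x2 y1 y2) :
    ∃ x, x ≤ x1 ∧ A.Box x x2 y1 y2 ∧ ∃ D, A.r D = x ∧ A.b D < y2 ∧ y1 < A.t D := by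
  obtain ⟨y, h1, h2, D, h3, h4, h5⟩ := h.rot.rot.rot.down
  have h2' := h2.rot
  simp only [Arr.rot] at h3 h4 h5
  refine ⟨y, by linarith, ?_, D, by linarith, by linarith, by linarith⟩
  have hcl := h2'.cl
  have hcr := h2'.cr
  have hcb := h2'.cb
  have hct := h2'.ct
  simp only [Arr.rot, neg_neg] at hcl hcr hcb hct
  refine ⟨by linarith [h2'.hx], by linarith [h2'.hy], hcl, by linarith, hcb, by linarith, ?_⟩
  intro i
  have := h2'.emp i
  simpa only [Arr.rot, neg_neg] using this

lemma Box.right [Finite ι] {A : Arr ι} {x1 x2 y1 y2 : ℝ} (h : A.Box x1 x2 y1 y2) :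
    ∃ x, x2 ≤ x ∧ A.Box x1 x y1 y2 ∧ ∃ D, A.l D = x ∧ A.b D < y2 ∧ y1 < A.t D := by
  obtain ⟨y, h1, h2, D, h3, h4, h5⟩ := h.flip.left
  have h2' := h2.flip
  simp only [Arr.flip] at h3 h4 h5
  refine ⟨-y, by linarith, ?_, D, by linarith, by linarith, by linarith⟩
  have hcl := h2'.cl
  have hcr := h2'.cr
  have hcb := h2'.cb
  have hct := h2'.ct
  simp only [Arr.flip, neg_neg] at hcl hcr hcb hct
  refine ⟨by linarith [h2'.hx], by linarith [h2'.hy], hcl, by linarith, hcb, by linarith, ?_⟩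
  intro i
  have := h2'.emp i
  simpa only [Arr.flip, neg_neg] using this

lemma Box.up [Finite ι] {A : Arr ι} {x1 x2 y1 y2 : ℝ} (h : A.Box x1 x2 y1 y2) :
    ∃ y, y2 ≤ y ∧ A.Box x1 x2 y1 y ∧ ∃ D, A.b D = y ∧ A.l D < x2 ∧ x1 < A.r D := by
  obtain ⟨y, h1, h2, D, h3, h4, h5⟩ := h.rot.right
  have h2' := h2.rot.rot.rot
  simp only [Arr.rot] at h3 h4 h5
  refine ⟨y, by linarith, ?_, D, by linarith, by linarith, by linarith⟩
  have hcl := h2'.cl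
  have hcr := h2'.cr
  have hcb := h2'.cb
  have hct := h2'.ct
  simp only [Arr.rot, neg_neg] at hcl hcr hcb hct
  refine ⟨by linarith [h2'.hx], by linarith [h2'.hy], hcl, by linarith, hcb, by linarith, ?_⟩
  intro i
  have := h2'.emp i
  simpa only [Arr.rot, neg_neg] using this

/-- An empty box touched on all four sides. -/
structure Box4 (A : Arr ι) (x1 x2 y1 y2 : ℝ) (L R B T : ι) : Prop extends A.Box x1 x2 y1 y2 where
  hL : A.r L = x1 ∧ A.b L < y2 ∧ y1 < A.t L
  hR : A.l R = x2 ∧ A.b R < y2 ∧ y1 < A.t R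
  hB : A.t B = y1 ∧ A.l B < x2 ∧ x1 < A.r B
  hT : A.b T = y2 ∧ A.l T < x2 ∧ x1 < A.r T

lemma Box4.rot {A : Arr ι} {x1 x2 y1 y2 : ℝ} {L R B T : ι} (h : A.Box4 x1 x2 y1 y2 L R B T) :
    A.rot.Box4 y1 y2 (-x2) (-x1) B T R L where
  toBox := h.toBox.rot
  hL := ⟨h.hB.1, neg_lt_neg h.hB.2.2, neg_lt_neg h.hB.2.1⟩
  hR := ⟨h.hT.1, neg_lt_neg h.hT.2.2, neg_lt_neg h.hT.2.1⟩
  hB := ⟨congrArg Neg.neg h.hR.1, h.hR.2⟩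
  hT := ⟨congrArg Neg.neg h.hL.1, h.hL.2⟩

lemma Box4.flip {A : Arr ι} {x1 x2 y1 y2 : ℝ} {L R B T : ι} (h : A.Box4 x1 x2 y1 y2 L R B T) :
    A.flip.Box4 (-x2) (-x1) y1 y2 R L B T where
  toBox := h.toBox.flip
  hL := ⟨congrArg Neg.neg h.hR.1, h.hR.2⟩
  hR := ⟨congrArg Neg.neg h.hL.1, h.hL.2⟩
  hB := ⟨h.hB.1, neg_lt_neg h.hB.2.2, neg_lt_neg h.hB.2.1⟩
  hT := ⟨h.hT.1, neg_lt_neg h.hT.2.2, neg_lt_neg h.hT.2.1⟩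

lemma Box4.extB {A : Arr ι} {x1 x2 y1 y2 : ℝ} {L R B T : ι} (h : A.Box4 x1 x2 y1 y2 L R B T) :
    A.l B < x1 ∨ x2 < A.r B := by
  obtain ⟨j, h1, h2, h3⟩ := A.blkT B (by linarith [h.hB.1, h.hy, h.ct])
  have := A.hbt j
  rcases h.emp j with h4 | h4 | h4 | h4
  · right; linarith
  · left; linarith
  · linarith [h.hB.1, h.hy]
  · linarith [h.hB.1]

lemma Box4.notBL {A : Arr ι} {x1 x2 y1 y2 : ℝ} {L R B T : ι} (h : A.Box4 x1 x2 y1 y2 L R B T) :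
    ¬ (A.l B < x1 ∧ A.b L < y1) := by
  rintro ⟨h1, h2⟩
  obtain ⟨a1, a2, a3⟩ := h.hB
  obtain ⟨b1, b2, b3⟩ := h.hL
  have := A.hlr L
  have := A.hbt B
  have := A.eq_of_overlap (i := B) (j := L) (by linarith) (by linarith) (by linarith) (by linarith)
  subst this
  linarith

lemma Box4.ext {A : Arr ι} {x1 x2 y1 y2 : ℝ} {L R B T : ι} (h : A.Box4 x1 x2 y1 y2 L R B T) :
    (A.l B < x1 ∨ x2 < A.r B) ∧ (A.b R < y1 ∨ y2 < A.t R) ∧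
    (A.l T < x1 ∨ x2 < A.r T) ∧ (A.b L < y1 ∨ y2 < A.t L) ∧
    ¬ (A.l B < x1 ∧ A.b L < y1) ∧ ¬ (x2 < A.r B ∧ A.b R < y1) ∧
    ¬ (x2 < A.r T ∧ y2 < A.t R) ∧ ¬ (A.l T < x1 ∧ y2 < A.t L) := by
  have e1 := h.extB
  have e2 := h.rot.extB
  have e3 := h.rot.rot.extB
  have e4 := h.rot.rot.rot.extB
  have n1 := h.notBL
  have n2 := h.rot.notBL
  have n3 := h.rot.rot.notBL
  have n4 := h.rot.rot.rot.notBL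
  simp only [Arr.rot, neg_neg, neg_lt_neg_iff] at e2 e3 e4 n2 n3 n4
  tauto

lemma Box4.cyc {A : Arr ι} {x1 x2 y1 y2 : ℝ} {L R B T : ι} (h : A.Box4 x1 x2 y1 y2 L R B T) :
    (A.l B < x1 ∧ A.b R < y1 ∧ x2 < A.r T ∧ y2 < A.t L ∧ A.r B ≤ x2 ∧ A.t R ≤ y2) ∨
    (A.b L < y1 ∧ A.l T < x1 ∧ y2 < A.t R ∧ x2 < A.r B ∧ x1 ≤ A.l B ∧ A.t L ≤ y2) := by
  have hx := h.ext
  simp only [← not_lt]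
  tauto

lemma Box4.coverB [Finite ι] {A : Arr ι} {x1 x2 y1 y2 : ℝ} {L R B T : ι}
    (h : A.Box4 x1 x2 y1 y2 L R B T) (hl : A.l B < x1) : A.r B = x2 := by
  obtain ⟨-, hR, hT, -, hrB, hRt⟩ := h.cyc.resolve_right (fun hh => by linarith [hh.2.2.2.2.1])
  by_contra hne
  have hlt : A.r B < x2 := lt_of_le_of_ne hrB hne
  obtain ⟨a1, a2, a3⟩ := h.hB
  obtain ⟨b1, b2, b3⟩ := h.hR
  obtain ⟨c1, c2, c3⟩ := h.hT
  have bx : A.Box (A.r B) x2 y1 y2 := by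
    refine ⟨hlt, h.hy, by linarith [h.cl], h.cr, h.cb, h.ct, fun i => ?_⟩
    rcases h.emp i with h1 | h1 | h1 | h1
    · exact Or.inl h1
    · right; left; linarith
    · exact Or.inr (Or.inr (Or.inl h1))
    · exact Or.inr (Or.inr (Or.inr h1))
  obtain ⟨y, hy1, hbox, D, d1, d2, d3⟩ := bx.down
  have hBb := A.hbt B
  have hDb := A.hbt D
  have hBl := A.hlr B
  have hDl := A.hlr D
  rcases eq_or_lt_of_le hy1 with he | hlt'
  · have h' : A.Box4 x1 x2 y1 y2 L R D T :=
      ⟨h.toBox, h.hL, h.hR, ⟨by linarith, d2, by linarith⟩, h.hT⟩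
    have hDl : A.l D < x1 := by
      rcases h'.cyc with hh | hh
      · exact hh.1
      · linarith [hh.2.2.1]
    have := A.eq_of_overlap (i := D) (j := B) (by linarith) (by linarith) (by linarith)
      (by linarith)
    subst this
    linarith
  · have h' : A.Box4 (A.r B) x2 y y2 B R D T :=
      ⟨hbox, ⟨rfl, by linarith [h.hy], by linarith⟩, ⟨b1, b2, by linarith⟩, ⟨d1, d2, d3⟩,
        ⟨c1, c2, by linarith⟩⟩
    rcases h'.cyc with hh | hh
    · linarith [hh.2.2.2.1, h.hy]
    · linarith [hh.2.2.1]

/-- A hole: box and pinwheel orientation. -/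
structure Q where
  l : ℝ
  r : ℝ
  b : ℝ
  t : ℝ
  s : Bool

/-- Pinwheel of the first orientation. -/
def PinT (A : Arr ι) (x1 x2 y1 y2 : ℝ) (L R B T : ι) : Prop :=
  (A.r L = x1 ∧ A.b L = y1 ∧ y2 < A.t L) ∧ (A.l R = x2 ∧ A.t R = y2 ∧ A.b R < y1) ∧
  (A.t B = y1 ∧ A.r B = x2 ∧ A.l B < x1) ∧ (A.b T = y2 ∧ A.l T = x1 ∧ x2 < A.r T)

/-- Pinwheel of the second orientation. -/
def PinF (A : Arr ι) (x1 x2 y1 y2 : ℝ) (L R B T : ι) : Prop :=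
  (A.r L = x1 ∧ A.t L = y2 ∧ A.b L < y1) ∧ (A.l R = x2 ∧ A.b R = y1 ∧ y2 < A.t R) ∧
  (A.t B = y1 ∧ A.l B = x1 ∧ x2 < A.r B) ∧ (A.b T = y2 ∧ A.r T = x2 ∧ A.l T < x1)

lemma Box4.pinT [Finite ι] {A : Arr ι} {x1 x2 y1 y2 : ℝ} {L R B T : ι}
    (h : A.Box4 x1 x2 y1 y2 L R B T) (hl : A.l B < x1) : A.PinT x1 x2 y1 y2 L R B T := by
  obtain ⟨-, hR, hT, hL, -, -⟩ := h.cyc.resolve_right (fun hh => by linarith [hh.2.2.2.2.1])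
  have c1 := h.coverB hl
  have c2 := h.rot.coverB (by simpa [Arr.rot] using hR)
  have c3 := h.rot.rot.coverB (by simpa [Arr.rot] using hT)
  have c4 := h.rot.rot.rot.coverB (by simpa [Arr.rot] using hL)
  simp only [Arr.rot, neg_neg, neg_inj] at c2 c3 c4
  exact ⟨⟨h.hL.1, c4, hL⟩, ⟨h.hR.1, c2, hR⟩, ⟨h.hB.1, c1, hl⟩, ⟨h.hT.1, c3, hT⟩⟩

lemma Box4.pin [Finite ι] {A : Arr ι} {x1 x2 y1 y2 : ℝ} {L R B T : ι}
    (h : A.Box4 x1 x2 y1 y2 L R B T) :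
    A.PinT x1 x2 y1 y2 L R B T ∨ A.PinF x1 x2 y1 y2 L R B T := by
  rcases h.extB with hl | hr
  · exact Or.inl (h.pinT hl)
  · right
    have := h.flip.pinT (by simpa [Arr.flip] using hr)
    simp only [PinT, Arr.flip, neg_inj, neg_lt_neg_iff] at this
    obtain ⟨⟨a1, a2, a3⟩, ⟨b1, b2, b3⟩, ⟨c1, c2, c3⟩, ⟨d1, d2, d3⟩⟩ := this
    exact ⟨⟨b1, b2, b3⟩, ⟨a1, a2, a3⟩, ⟨c1, c2, c3⟩, ⟨d1, d2, d3⟩⟩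

/-- `q` is a hole of the arrangement. -/
structure IsHole (A : Arr ι) (q : Q) : Prop extends A.Box q.l q.r q.b q.t where
  pin : ∃ L R B T, (q.s = true ∧ A.PinT q.l q.r q.b q.t L R B T) ∨
    (q.s = false ∧ A.PinF q.l q.r q.b q.t L R B T)

lemma Box.exists_hole [Finite ι] {A : Arr ι} {x1 x2 y1 y2 : ℝ} (h : A.Box x1 x2 y1 y2) :
    ∃ q, A.IsHole q ∧ q.l ≤ x1 ∧ x2 ≤ q.r ∧ q.b ≤ y1 ∧ y2 ≤ q.t := by
  obtain ⟨u1, hu1, h1, L, hL1, hL2, hL3⟩ := h.left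
  obtain ⟨u2, hu2, h2, R, hR1, hR2, hR3⟩ := h1.right
  obtain ⟨v1, hv1, h3, B, hB1, hB2, hB3⟩ := h2.down
  obtain ⟨v2, hv2, h4, T, hT1, hT2, hT3⟩ := h3.up
  have h5 : A.Box4 u1 u2 v1 v2 L R B T :=
    ⟨h4, ⟨hL1, by linarith, by linarith⟩, ⟨hR1, by linarith, by linarith⟩, ⟨hB1, hB2, hB3⟩,
      ⟨hT1, hT2, hT3⟩⟩
  rcases h5.pin with hp | hp
  · exact ⟨⟨u1, u2, v1, v2, true⟩, ⟨h4, L, R, B, T, Or.inl ⟨rfl, hp⟩⟩, hu1, hu2, hv1, hv2⟩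
  · exact ⟨⟨u1, u2, v1, v2, false⟩, ⟨h4, L, R, B, T, Or.inr ⟨rfl, hp⟩⟩, hu1, hu2, hv1, hv2⟩

/-- Facts about the four neighbours common to both orientations. -/
lemma IsHole.nbr {A : Arr ι} {q : Q} (h : A.IsHole q) : ∃ L R B T,
    (A.r L = q.l ∧ A.b L ≤ q.b ∧ q.t ≤ A.t L) ∧ (A.l R = q.r ∧ A.b R ≤ q.b ∧ q.t ≤ A.t R) ∧
    (A.t B = q.b ∧ A.l B ≤ q.l ∧ q.r ≤ A.r B) ∧ (A.b T = q.t ∧ A.l T ≤ q.l ∧ q.r ≤ A.r T) := by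
  have h1 := h.hx
  have h2 := h.hy
  obtain ⟨L, R, B, T, ⟨-, hp⟩ | ⟨-, hp⟩⟩ := h.pin <;>
  · obtain ⟨⟨a1, a2, a3⟩, ⟨b1, b2, b3⟩, ⟨c1, c2, c3⟩, ⟨d1, d2, d3⟩⟩ := hp
    refine ⟨L, R, B, T, ⟨?_, ?_, ?_⟩, ⟨?_, ?_, ?_⟩, ⟨?_, ?_, ?_⟩, ⟨?_, ?_, ?_⟩⟩ <;> linarith

/-- Two holes whose closed `x`-ranges meet and open `y`-ranges meet coincide. -/
lemma IsHole.eq {A : Arr ι} {p q : Q} (hp : A.IsHole p) (hq : A.IsHole q)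
    (h1 : p.l ≤ q.r) (h2 : q.l ≤ p.r) (h3 : p.b < q.t) (h4 : q.b < p.t) : p = q := by
  have hpx := hp.hx
  have hpy := hp.hy
  have hqx := hq.hx
  have hqy := hq.hy
  obtain ⟨L, R, B, T, ⟨a1, a2, a3⟩, ⟨b1, b2, b3⟩, ⟨c1, c2, c3⟩, ⟨d1, d2, d3⟩⟩ := hp.nbr
  obtain ⟨L', R', B', T', ⟨a1', a2', a3'⟩, ⟨b1', b2', b3'⟩, ⟨c1', c2', c3'⟩, ⟨d1', d2', d3'⟩⟩ :=
    hq.nbr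
  have w1 := A.hlr L
  have w2 := A.hlr L'
  have w3 := A.hlr R
  have w4 := A.hlr R'
  have w5 := A.hbt B
  have w6 := A.hbt B'
  have w7 := A.hbt T
  have w8 := A.hbt T'
  have el : p.l = q.l := by
    apply le_antisymm
    · by_contra hh
      rcases hq.emp L with h | h | h | h <;> linarith
    · by_contra hh
      rcases hp.emp L' with h | h | h | h <;> linarith
  have er : p.r = q.r := by
    apply le_antisymm
    · by_contra hh
      rcases hp.emp R' with h | h | h | h <;> linarith
    · by_contra hh
      rcases hq.emp R with h | h | h | h <;> linarith
  have eb : p.b = q.b := by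
    apply le_antisymm
    · by_contra hh
      rcases hq.emp B with h | h | h | h <;> linarith
    · by_contra hh
      rcases hp.emp B' with h | h | h | h <;> linarith
  have et : p.t = q.t := by
    apply le_antisymm
    · by_contra hh
      rcases hp.emp T' with h | h | h | h <;> linarith
    · by_contra hh
      rcases hq.emp T with h | h | h | h <;> linarith
  have key : ∀ (p q : Q), A.IsHole p → A.IsHole q → p.l = q.l → p.r = q.r → p.b = q.b →
      p.s = true → q.s = false → False := by
    clear * -
    intro p q hp hq hl hr hb sp sq
    obtain ⟨L, R, B, T, ⟨-, hp'⟩ | ⟨hc, -⟩⟩ := hp.pin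
    swap
    · simp [sp] at hc
    obtain ⟨L', R', B', T', ⟨hc, -⟩ | ⟨-, hq'⟩⟩ := hq.pin
    · simp [sq] at hc
    obtain ⟨-, -, ⟨c1, c2, c3⟩, -⟩ := hp'
    obtain ⟨-, -, ⟨d1, d2, d3⟩, -⟩ := hq'
    have w5 := A.hbt B
    have w6 := A.hbt B'
    have := hp.hx
    have := A.eq_of_overlap (i := B) (j := B') (by linarith) (by linarith) (by linarith)
      (by linarith)
    subst this
    linarith
  have es : p.s = q.s := by
    cases hs : p.s <;> cases hs' : q.s
    · rfl
    · exact (key q p hq hp el.symm er.symm eb.symm hs' hs).elim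
    · exact (key p q hp hq el er eb hs hs').elim
    · rfl
  cases p
  cases q
  simp_all

/-- Height of the left exit. -/
def Q.yl (q : Q) : ℝ := if q.s then q.b else q.t
/-- Height of the right exit. -/
def Q.yr (q : Q) : ℝ := if q.s then q.t else q.b
/-- Abscissa of the corner of `q` that is the top left corner of a neighbour. -/
def Q.tlx (q : Q) : ℝ := if q.s then q.r else q.l

lemma IsHole.yl_mem {A : Arr ι} {q : Q} (h : A.IsHole q) : q.b ≤ q.yl ∧ q.yl ≤ q.t := by
  have := h.hy
  unfold Q.yl
  split_ifs <;> constructor <;> linarith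

/-- The left exit of `q` ends at abscissa `x`. -/
structure Exit (A : Arr ι) (q : Q) (x : ℝ) : Prop where
  str : ∃ S, A.r S = x ∧ A.b S < q.yl ∧ q.yl < A.t S
  lt : x < q.l
  cl : A.cl ≤ x
  max : ∀ i, A.b i < q.yl → q.yl < A.t i → A.l i < q.r → A.r i ≤ x

/-- All holes lie strictly inside the frame. -/
def Inside (A : Arr ι) : Prop :=
  ∀ q, A.IsHole q → A.cl < q.l ∧ q.r < A.cr ∧ A.cb < q.b ∧ q.t < A.ct

lemma Exit.unique {A : Arr ι} {q : Q} (hq : A.IsHole q) {x y : ℝ} (h1 : A.Exit q x)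
    (h2 : A.Exit q y) : x = y := by
  have := hq.hx
  obtain ⟨S, s1, s2, s3⟩ := h1.str
  obtain ⟨S', s1', s2', s3'⟩ := h2.str
  have := A.hlr S
  have := A.hlr S'
  have := h1.lt
  have := h2.lt
  have := h1.max S' s2' s3' (by linarith)
  have := h2.max S s2 s3 (by linarith)
  linarith

lemma IsHole.exists_exit [Finite ι] {A : Arr ι} (hA : A.Inside) {q : Q} (h : A.IsHole q) :
    ∃ x, A.Exit q x := by
  classical
  have := Fintype.ofFinite ι
  obtain ⟨i1, i2, i3, i4⟩ := hA q h
  obtain ⟨y1, y2⟩ := h.yl_mem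
  have hx := h.hx
  have hy := h.hy
  obtain ⟨w, hw1, hw2, hw3⟩ := A.wallL
  let S : Finset ι := Finset.univ.filter (fun i => A.b i < q.yl ∧ q.yl < A.t i ∧ A.r i ≤ q.l)
  have hwS : w ∈ S := by
    simp only [S, Finset.mem_filter, Finset.mem_univ, true_and]
    exact ⟨by linarith, by linarith, by linarith⟩
  obtain ⟨D, hD, hmax⟩ := Finset.exists_max_image S A.r ⟨w, hwS⟩
  simp only [S, Finset.mem_filter, Finset.mem_univ, true_and] at hD
  obtain ⟨d1, d2, d3⟩ := hD
  refine ⟨A.r D, ⟨D, rfl, d1, d2⟩, ?_, ?_, ?_⟩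
  · apply lt_of_le_of_ne d3
    intro he
    have e1 := A.hlr D
    obtain ⟨L, R, B, T, ⟨hs, hp⟩ | ⟨hs, hp⟩⟩ := h.pin
    · obtain ⟨-, -, ⟨c1, c2, c3⟩, -⟩ := hp
      have e2 := A.hbt B
      simp only [Q.yl, hs, if_true] at d1 d2
      have := A.eq_of_overlap (i := D) (j := B) (by linarith) (by linarith) (by linarith)
        (by linarith)
      subst this
      linarith
    · obtain ⟨-, -, -, ⟨c1, c2, c3⟩⟩ := hp
      have e2 := A.hbt T
      simp only [Q.yl, hs] at d1 d2
      simp at d1 d2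
      have := A.eq_of_overlap (i := D) (j := T) (by linarith) (by linarith) (by linarith)
        (by linarith)
      subst this
      linarith
  · rw [← hw1]; exact hmax w hwS
  · intro i h1 h2 h3
    by_cases h4 : A.r i ≤ q.l
    · apply hmax
      simp only [S, Finset.mem_filter, Finset.mem_univ, true_and]
      exact ⟨h1, h2, h4⟩
    · exfalso
      rcases h.emp i with h | h | h | h <;> linarith

lemma Exit.r_le {A : Arr ι} {p q : Q} (hp : A.IsHole p) (hq : A.IsHole q) {x : ℝ}
    (h1 : A.Exit p x) (h2 : A.Exit q x) (he : p.yl = q.yl) : q.r ≤ p.r := by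
  by_contra hlt
  have hx := hp.hx
  have hy := hp.hy
  have := h1.lt
  obtain ⟨L, R, B, T, ⟨hs, hpin⟩ | ⟨hs, hpin⟩⟩ := hp.pin
  · obtain ⟨-, ⟨c1, c2, c3⟩, -, -⟩ := hpin
    have e2 := A.hlr R
    have e : p.yl = p.b := by simp [Q.yl, hs]
    have := h2.max R (by linarith) (by linarith) (by linarith)
    linarith
  · obtain ⟨-, ⟨c1, c2, c3⟩, -, -⟩ := hpin
    have e2 := A.hlr R
    have e : p.yl = p.t := by simp [Q.yl, hs]
    have := h2.max R (by linarith) (by linarith) (by linarith)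
    linarith

lemma Exit.ts_false {A : Arr ι} {p q : Q} (hp : A.IsHole p) (hq : A.IsHole q)
    (he : p.yl = q.yl) (er : p.r = q.r) (hs : p.s = true) (hs' : q.s = false) : False := by
  have hx := hp.hx
  have hqx := hq.hx
  have hqy := hq.hy
  obtain ⟨L, R, B, T, ⟨-, hpin⟩ | ⟨hc, -⟩⟩ := hp.pin
  · obtain ⟨-, -, ⟨c1, c2, c3⟩, -⟩ := hpin
    have e2 := A.hbt B
    have e : p.yl = p.b := by simp [Q.yl, hs]
    have e' : q.yl = q.t := by simp [Q.yl, hs']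
    rcases hq.emp B with h | h | h | h <;> linarith
  · simp [hs] at hc

lemma Exit.inj {A : Arr ι} {p q : Q} (hp : A.IsHole p) (hq : A.IsHole q) {x : ℝ}
    (h1 : A.Exit p x) (h2 : A.Exit q x) (he : p.yl = q.yl) : p = q := by
  have er : p.r = q.r := le_antisymm (h2.r_le hq hp h1 he.symm) (h1.r_le hp hq h2 he)
  have := hp.hx
  have := hq.hx
  have := hp.hy
  have := hq.hy
  cases hs : p.s <;> cases hs' : q.s
  · simp [Q.yl, hs, hs'] at he
    exact hp.eq hq (by linarith) (by linarith) (by linarith) (by linarith)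
  · exact (Exit.ts_false hq hp he.symm er.symm hs' hs).elim
  · exact (Exit.ts_false hp hq he er hs hs').elim
  · simp [Q.yl, hs, hs'] at he
    exact hp.eq hq (by linarith) (by linarith) (by linarith) (by linarith)

/-- `q'` is the next hole to the left of `q` along its exit. -/
def NL (A : Arr ι) (q q' : Q) : Prop := A.Exit q q'.l ∧ q.yl = q'.yr

lemma NL.inj {A : Arr ι} {p q q' : Q} (hp : A.IsHole p) (hq : A.IsHole q)
    (h1 : A.NL p q') (h2 : A.NL q q') : p = q :=
  Exit.inj hp hq h1.1 h2.1 (h1.2.trans h2.2.symm)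

lemma NL.r_lt {A : Arr ι} {q q' : Q} (hq : A.IsHole q) (hq' : A.IsHole q')
    (h : A.NL q q') : q'.r < q.l := by
  by_contra hlt
  have h1 := h.1.lt
  have h2 := h.2
  have := hq.hx
  have := hq.hy
  have := hq'.hx
  have := hq'.hy
  obtain ⟨L, R, B, T, ⟨hs, hpin⟩ | ⟨hs, hpin⟩⟩ := hq.pin
  · obtain ⟨⟨a1, a2, a3⟩, ⟨b1, b2, b3⟩, ⟨c1, c2, c3⟩, ⟨d1, d2, d3⟩⟩ := hpin
    have e1 := A.hlr L
    have e2 := A.hbt B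
    cases hs' : q'.s <;> simp [Q.yl, Q.yr, hs, hs'] at h2
    · rcases hq'.emp L with h | h | h | h <;> linarith
    · rcases hq'.emp B with h | h | h | h <;> linarith
  · obtain ⟨⟨a1, a2, a3⟩, ⟨b1, b2, b3⟩, ⟨c1, c2, c3⟩, ⟨d1, d2, d3⟩⟩ := hpin
    have e1 := A.hlr L
    have e2 := A.hbt T
    cases hs' : q'.s <;> simp [Q.yl, Q.yr, hs, hs'] at h2
    · rcases hq'.emp T with h | h | h | h <;> linarith
    · rcases hq'.emp L with h | h | h | h <;> linarith

/-- A point's south-east quadrant lies in a rectangle or in a hole. -/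
lemma quadrant [Finite ι] (A : Arr ι) {x y : ℝ} (h1 : A.cl ≤ x) (h2 : x < A.cr)
    (h3 : A.cb < y) (h4 : y ≤ A.ct) :
    (∃ i, A.l i ≤ x ∧ x < A.r i ∧ A.b i < y ∧ y ≤ A.t i) ∨
    (∃ q, A.IsHole q ∧ q.l ≤ x ∧ x < q.r ∧ q.b < y ∧ y ≤ q.t) := by
  by_cases hr : ∃ i, A.l i ≤ x ∧ x < A.r i ∧ A.b i < y ∧ y ≤ A.t i
  · exact Or.inl hr
  right
  have hev : ∀ᶠ e : ℝ in nhdsWithin 0 (Set.Ioi 0), 0 < e ∧ e < A.cr - x ∧ e < y - A.cb ∧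
      ∀ i, (x < A.l i → e < A.l i - x) ∧ (A.t i < y → e < y - A.t i) := by
    have key : ∀ c : ℝ, 0 < c → ∀ᶠ e : ℝ in nhdsWithin 0 (Set.Ioi 0), e < c := fun c hc =>
      nhdsWithin_le_nhds (Iio_mem_nhds hc)
    refine Filter.Eventually.and self_mem_nhdsWithin ((key _ (by linarith)).and ((key _ (by linarith)).and ?_))
    rw [Filter.eventually_all]
    intro i
    refine Filter.Eventually.and ?_ ?_
    · by_cases hh : x < A.l i
      · filter_upwards [key (A.l i - x) (by linarith)] with e he _ using he
      · simp [hh]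
    · by_cases hh : A.t i < y
      · filter_upwards [key (y - A.t i) (by linarith)] with e he _ using he
      · simp [hh]
  obtain ⟨e, he0, he1, he2, he⟩ := hev.exists
  have hb : A.Box x (x + e) (y - e) y := by
    refine ⟨by linarith, by linarith, h1, by linarith, by linarith, h4, fun i => ?_⟩
    by_cases c1 : A.l i ≤ x
    · by_cases c2 : x < A.r i
      · by_cases c3 : A.b i < y
        · by_cases c4 : y ≤ A.t i
          · exact (hr ⟨i, c1, c2, c3, c4⟩).elim
          · right; right; right
            have := (he i).2 (by linarith)
            linarith
        · right; right; left; linarith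
      · right; left; linarith
    · left
      have := (he i).1 (by linarith)
      linarith
  obtain ⟨q, hq, g1, g2, g3, g4⟩ := hb.exists_hole
  exact ⟨q, hq, g1, by linarith, by linarith, g4⟩

lemma Exit.dich [Finite ι] {A : Arr ι} (hA : A.Inside) {q : Q} (hq : A.IsHole q) {x : ℝ}
    (h : A.Exit q x) : (∃ q', A.IsHole q' ∧ A.NL q q') ∨ (∃ i, A.l i = x ∧ A.t i = q.yl) := by
  obtain ⟨i1, i2, i3, i4⟩ := hA q hq
  obtain ⟨y1, y2⟩ := hq.yl_mem
  have hx := hq.hx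
  have hy := hq.hy
  have hlt := h.lt
  obtain ⟨S, s1, s2, s3⟩ := h.str
  have hS := A.hlr S
  rcases A.quadrant (x := x) (y := q.yl) h.cl (by linarith) (by linarith) (by linarith) with
    ⟨i, a1, a2, a3, a4⟩ | ⟨q', hq', a1, a2, a3, a4⟩
  · right
    have e1 : A.l i = x := by
      by_contra hne
      have hl := lt_of_le_of_ne a1 hne
      have := A.eq_of_overlap (i := i) (j := S) (by linarith) (by linarith) (by linarith)
        (by linarith)
      subst this
      linarith
    refine ⟨i, e1, ?_⟩
    by_contra hne
    have hl := lt_of_le_of_ne a4 (Ne.symm hne)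
    have := h.max i a3 hl (by linarith)
    linarith
  · left
    have hx' := hq'.hx
    have e1 : q'.l = x := by
      by_contra hne
      have hl := lt_of_le_of_ne a1 hne
      rcases hq'.emp S with h | h | h | h <;> linarith
    have e2 : q'.t = q.yl := by
      by_contra hne
      have hl := lt_of_le_of_ne a4 (Ne.symm hne)
      obtain ⟨-, R', -, -, -, ⟨c1, c2, c3⟩, -, -⟩ := hq'.nbr
      have hR := A.hlr R'
      by_cases hr : q'.r < q.r
      · have := h.max R' (by linarith) (by linarith) (by linarith)
        linarith
      · obtain ⟨L, R, B, T, ⟨hs, hpin⟩ | ⟨hs, hpin⟩⟩ := hq.pin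
        · obtain ⟨-, -, ⟨c1, c2, c3⟩, -⟩ := hpin
          have e2 := A.hbt B
          have e : q.yl = q.b := by simp [Q.yl, hs]
          rcases hq'.emp B with h | h | h | h <;> linarith
        · obtain ⟨-, -, -, ⟨c1, c2, c3⟩⟩ := hpin
          have e2 := A.hbt T
          have e : q.yl = q.t := by simp [Q.yl, hs]
          rcases hq'.emp T with h | h | h | h <;> linarith
    refine ⟨q', hq', by rw [e1]; exact h, ?_⟩
    obtain ⟨L, R, B, T, ⟨hs, hpin⟩ | ⟨hs, hpin⟩⟩ := hq'.pin
    · simp [Q.yr, hs, e2]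
    · exfalso
      obtain ⟨-, -, -, ⟨c1, c2, c3⟩⟩ := hpin
      have e2 := A.hbt T
      have := A.eq_of_overlap (i := S) (j := T) (by linarith) (by linarith) (by linarith)
        (by linarith)
      subst this
      linarith

/-- Each hole is adjacent to the top left corner of a rectangle. -/
lemma IsHole.exists_tl {A : Arr ι} {q : Q} (h : A.IsHole q) :
    ∃ i, A.l i = q.tlx ∧ A.t i = q.yr := by
  obtain ⟨L, R, B, T, ⟨hs, hpin⟩ | ⟨hs, hpin⟩⟩ := h.pin
  · obtain ⟨-, ⟨c1, c2, c3⟩, -, -⟩ := hpin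
    exact ⟨R, by simp [Q.tlx, hs, c1], by simp [Q.yr, hs, c2]⟩
  · obtain ⟨-, -, ⟨c1, c2, c3⟩, -⟩ := hpin
    exact ⟨B, by simp [Q.tlx, hs, c2], by simp [Q.yr, hs, c1]⟩

lemma IsHole.tl_ts {A : Arr ι} {p q : Q} (hp : A.IsHole p) (hq : A.IsHole q)
    (hx : p.tlx = q.tlx) (hy : p.yr = q.yr) (hs : p.s = true) (hs' : q.s = false) : False := by
  have := hp.hx
  have := hq.hx
  have := hp.hy
  have := hq.hy
  obtain ⟨L, R, B, T, ⟨-, hpin⟩ | ⟨hc, -⟩⟩ := hp.pin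
  · obtain ⟨-, -, -, ⟨c1, c2, c3⟩⟩ := hpin
    have e2 := A.hbt T
    simp [Q.tlx, Q.yr, hs, hs'] at hx hy
    rcases hq.emp T with h | h | h | h <;> linarith
  · simp [hs] at hc

lemma IsHole.tl_inj {A : Arr ι} {p q : Q} (hp : A.IsHole p) (hq : A.IsHole q)
    (hx : p.tlx = q.tlx) (hy : p.yr = q.yr) : p = q := by
  have := hp.hx
  have := hq.hx
  have := hp.hy
  have := hq.hy
  cases hs : p.s <;> cases hs' : q.s
  · simp [Q.tlx, Q.yr, hs, hs'] at hx hy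
    exact hp.eq hq (by linarith) (by linarith) (by linarith) (by linarith)
  · exact (IsHole.tl_ts hq hp hx.symm hy.symm hs' hs).elim
  · exact (IsHole.tl_ts hp hq hx hy hs hs').elim
  · simp [Q.tlx, Q.yr, hs, hs'] at hx hy
    exact hp.eq hq (by linarith) (by linarith) (by linarith) (by linarith)

/-- A terminal corner is not the top left corner attached to a hole. -/
lemma Exit.ne_tl {A : Arr ι} {p q : Q} (hp : A.IsHole p) {x : ℝ}
    (h : A.Exit q x) (hx : x = p.tlx) (hy : q.yl = p.yr) : A.NL q p := by
  obtain ⟨S, s1, s2, s3⟩ := h.str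
  have hS := A.hlr S
  have := hp.hx
  have := hp.hy
  obtain ⟨L, R, B, T, ⟨hs, hpin⟩ | ⟨hs, hpin⟩⟩ := hp.pin
  · exfalso
    obtain ⟨-, -, -, ⟨c1, c2, c3⟩⟩ := hpin
    have e2 := A.hbt T
    simp only [Q.tlx, Q.yr, hs, if_true] at hx hy
    have := A.eq_of_overlap (i := S) (j := T) (by linarith) (by linarith) (by linarith)
      (by linarith)
    subst this
    linarith
  · refine ⟨?_, hy⟩
    have : x = p.l := by simpa [Q.tlx, hs] using hx
    rw [← this]; exact h

/-- Image of a hole under `(x, y) ↦ (-y, -x)`. -/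
def Q.anti (q : Q) : Q := ⟨-q.t, -q.b, -q.r, -q.l, !q.s⟩

lemma Q.anti_anti (q : Q) : q.anti.anti = q := by
  cases q; simp [Q.anti]

lemma anti_anti (A : Arr ι) : A.anti.anti = A := by
  cases A; simp [anti, rot, flip]

lemma IsHole.anti {A : Arr ι} {q : Q} (h : A.IsHole q) : A.anti.IsHole q.anti := by
  refine ⟨h.toBox.rot.flip, ?_⟩
  obtain ⟨L, R, B, T, ⟨hs, hp⟩ | ⟨hs, hp⟩⟩ := h.pin
  · refine ⟨T, B, R, L, Or.inr ⟨by simp [Q.anti, hs], ?_⟩⟩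
    obtain ⟨⟨a1, a2, a3⟩, ⟨b1, b2, b3⟩, ⟨c1, c2, c3⟩, ⟨d1, d2, d3⟩⟩ := hp
    simp only [PinF, Q.anti, Arr.anti, Arr.rot, Arr.flip, neg_inj, neg_lt_neg_iff]
    tauto
  · refine ⟨T, B, R, L, Or.inl ⟨by simp [Q.anti, hs], ?_⟩⟩
    obtain ⟨⟨a1, a2, a3⟩, ⟨b1, b2, b3⟩, ⟨c1, c2, c3⟩, ⟨d1, d2, d3⟩⟩ := hp
    simp only [PinT, Q.anti, Arr.anti, Arr.rot, Arr.flip, neg_inj, neg_lt_neg_iff]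
    tauto

lemma IsHole.of_anti {A : Arr ι} {q : Q} (h : A.anti.IsHole q) : A.IsHole q.anti := by
  have := h.anti
  rwa [A.anti_anti] at this

lemma Inside.anti {A : Arr ι} (h : A.Inside) : A.anti.Inside := by
  intro q hq
  obtain ⟨h1, h2, h3, h4⟩ := h _ hq.of_anti
  simp only [Q.anti] at h1 h2 h3 h4
  simp only [Arr.anti, Arr.rot, Arr.flip]
  refine ⟨?_, ?_, ?_, ?_⟩ <;> linarith

lemma IsHole.yr_mem {A : Arr ι} {q : Q} (h : A.IsHole q) : q.b ≤ q.yr ∧ q.yr ≤ q.t := by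
  have := h.hy
  unfold Q.yr
  split_ifs <;> constructor <;> linarith

/-- `p'` is the next hole above `p`. -/
def NU (A : Arr ι) (p p' : Q) : Prop := A.anti.NL p.anti p'.anti

lemma NU.t_lt {A : Arr ι} {p p' : Q} (hp : A.IsHole p) (hp' : A.IsHole p') (h : A.NU p p') :
    p.t < p'.b := by
  have := NL.r_lt hp.anti hp'.anti h
  simp only [Q.anti] at this
  linarith

lemma NU.common {A : Arr ι} {p p' : Q} (hp : A.IsHole p) (hp' : A.IsHole p') (h : A.NU p p') :
    ∃ c, p.l ≤ c ∧ c ≤ p.r ∧ p'.l ≤ c ∧ c ≤ p'.r := by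
  have h1 := hp.anti.yl_mem
  have h2 := hp'.anti.yr_mem
  have h3 := h.2
  refine ⟨-p.anti.yl, ?_⟩
  rw [← h3] at h2
  have e1 : p.anti.b = -p.r := rfl
  have e2 : p.anti.t = -p.l := rfl
  have e3 : p'.anti.b = -p'.r := rfl
  have e4 : p'.anti.t = -p'.l := rfl
  refine ⟨?_, ?_, ?_, ?_⟩ <;> linarith

/-- The set of holes. -/
abbrev H (A : Arr ι) : Type := {q : Q // A.IsHole q}

/-- A leftward path of holes. -/
structure Path (A : Arr ι) (u : ℕ → Q) (n : ℕ) : Prop where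
  hole : ∀ j, A.IsHole (u j)
  step : ∀ j, j < n → A.NL (u j) (u (j + 1))

/-- Heights along a path. -/
noncomputable def ht (u : ℕ → Q) (n j : ℕ) : ℝ := if j ≤ n then (u j).yr else (u n).yl

/-- The `j`-th segment meets the `x`-range of `P`. -/
def Act (u : ℕ → Q) (n j : ℕ) (P : Q) : Prop :=
  (1 ≤ j → P.l ≤ (u (j - 1)).r) ∧ (j ≤ n → (u j).l ≤ P.r)

lemma Path.l_anti {A : Arr ι} {u : ℕ → Q} {n : ℕ} (h : A.Path u n) {a b : ℕ} (hab : a ≤ b)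
    (hb : b ≤ n) : (u b).l ≤ (u a).l := by
  induction b, hab using Nat.le_induction with
  | base => exact le_rfl
  | succ b hab ih =>
    have h1 := ih (by omega)
    have h2 := NL.r_lt (h.hole b) (h.hole (b + 1)) (h.step b (by omega))
    have := (h.hole (b + 1)).hx
    linarith

lemma Path.r_anti {A : Arr ι} {u : ℕ → Q} {n : ℕ} (h : A.Path u n) {a b : ℕ} (hab : a ≤ b)
    (hb : b ≤ n) : (u b).r ≤ (u a).r := by
  induction b, hab using Nat.le_induction with
  | base => exact le_rfl
  | succ b hab ih =>
    have h1 := ih (by omega)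
    have h2 := NL.r_lt (h.hole b) (h.hole (b + 1)) (h.step b (by omega))
    have := (h.hole b).hx
    linarith

lemma Path.lt {A : Arr ι} {u : ℕ → Q} {n : ℕ} (h : A.Path u n) {a b : ℕ} (hab : a < b)
    (hb : b ≤ n) : (u b).r < (u a).l := by
  have h1 := h.r_anti (a := a + 1) (b := b) hab hb
  have h2 := NL.r_lt (h.hole a) (h.hole (a + 1)) (h.step a (by omega))
  linarith

lemma Path.ht_succ {A : Arr ι} {u : ℕ → Q} {n : ℕ} (h : A.Path u n) {j : ℕ} (hj : j ≤ n) :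
    ht u n (j + 1) = (u j).yl := by
  unfold ht
  split_ifs with h1
  · exact (h.step j (by omega)).2.symm
  · have : j = n := by omega
    rw [this]

lemma ht_le {u : ℕ → Q} {n j : ℕ} (hj : j ≤ n) : ht u n j = (u j).yr := by
  simp [ht, hj]

lemma Path.act_mid {A : Arr ι} {u : ℕ → Q} {n : ℕ} (h : A.Path u n) {P : Q} {i j k : ℕ}
    (hij : i ≤ j) (hjk : j ≤ k) (hk : k ≤ n + 1) (h1 : Act u n i P) (h2 : Act u n k P) :
    Act u n j P := by
  refine ⟨fun hj => ?_, fun hj => ?_⟩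
  · have := h2.1 (by omega)
    have := h.r_anti (a := j - 1) (b := k - 1) (by omega) (by omega)
    linarith
  · have := h1.2 (by omega)
    have := h.l_anti hij hj
    linarith

lemma Path.toggle {A : Arr ι} {u : ℕ → Q} {n : ℕ} (h : A.Path u n) {P : Q} (hP : A.IsHole P)
    (hne : ∀ j, j ≤ n → P ≠ u j) {j : ℕ} (hj : j ≤ n) (h1 : Act u n j P)
    (h2 : Act u n (j + 1) P) : ht u n j < P.t ↔ ht u n (j + 1) < P.t := by
  rw [h.ht_succ hj, ht_le hj]
  have a1 := h1.2 hj
  have a2 := h2.1 (by omega)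
  simp only [Nat.add_sub_cancel] at a2
  have e1 := (h.hole j).yl_mem
  have e2 := (h.hole j).yr_mem
  have e3 := hP.hy
  constructor
  · intro hh
    by_contra hc
    exact hne j hj (hP.eq (h.hole j) a2 a1 (by linarith) (by linarith))
  · intro hh
    by_contra hc
    exact hne j hj (hP.eq (h.hole j) a2 a1 (by linarith) (by linarith))

/-- `P` lies above the path. -/
def Above (u : ℕ → Q) (n : ℕ) (P : Q) : Prop :=
  ∀ j, j ≤ n + 1 → Act u n j P → ht u n j < P.t

lemma Path.spread {A : Arr ι} {u : ℕ → Q} {n : ℕ} (h : A.Path u n) {P : Q} (hP : A.IsHole P)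
    (hne : ∀ j, j ≤ n → P ≠ u j) {j0 : ℕ} (hj : j0 ≤ n + 1) (h1 : Act u n j0 P)
    (h2 : ht u n j0 < P.t) : Above u n P := by
  have up : ∀ j, j0 ≤ j → j ≤ n + 1 → Act u n j P → ht u n j < P.t := by
    intro j hjj
    induction j, hjj using Nat.le_induction with
    | base => intros; exact h2
    | succ j hjj ih =>
      intro h3 h4
      have h5 := h.act_mid hjj (Nat.le_succ j) h3 h1 h4
      exact (h.toggle hP hne (by omega) h5 h4).1 (ih (by omega) h5)
  have down : ∀ d j, j + d = j0 → Act u n j P → ht u n j < P.t := by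
    intro d
    induction d with
    | zero => intro j hj _; simp at hj; rw [hj]; exact h2
    | succ d ih =>
      intro j hjd h3
      have h5 : Act u n (j + 1) P := h.act_mid (Nat.le_succ j) (by omega) hj h3 h1
      exact (h.toggle hP hne (by omega) h3 h5).2 (ih (j + 1) (by omega) h5)
  intro j hj1 hj2
  rcases le_total j0 j with hh | hh
  · exact up j hh hj1 hj2
  · exact down (j0 - j) j (by omega) hj2

lemma Path.act_of {A : Arr ι} {u : ℕ → Q} {n : ℕ} (h : A.Path u n) {P : Q} {b : ℕ} (hb : b ≤ n)
    {c : ℝ} (h1 : P.l ≤ c) (h2 : c ≤ P.r) (h3 : (u b).l ≤ c) (h4 : c ≤ (u b).r) :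
    Act u n b P := by
  refine ⟨fun hj => ?_, fun hj => ?_⟩
  · have := h.r_anti (a := b - 1) (b := b) (by omega) hb
    linarith
  · linarith

lemma Path.not_above {A : Arr ι} {u : ℕ → Q} {n : ℕ} (h : A.Path u n) {b : ℕ} (hb : b ≤ n)
    (hA : Above u n (u b)) : False := by
  have hx := (h.hole b).hx
  have hy := (h.hole b).hy
  have h1 := hA b (by omega) (h.act_of hb le_rfl hx.le le_rfl hx.le)
  have h2 := hA (b + 1) (by omega) ⟨fun _ => hx.le, fun hh => by
    have := h.l_anti (a := b) (b := b + 1) (by omega) hh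
    linarith⟩
  rw [h.ht_succ hb] at h2
  rw [ht_le hb] at h1
  unfold Q.yl at h2
  unfold Q.yr at h1
  split_ifs at h1 h2 <;> linarith

lemma Path.base {A : Arr ι} {u : ℕ → Q} {n : ℕ} (h : A.Path u n) {b : ℕ} (hb : b ≤ n) {P : Q}
    (hP : A.IsHole P) (hN : A.NU (u b) P) : Above u n P := by
  obtain ⟨c, c1, c2, c3, c4⟩ := NU.common (h.hole b) hP hN
  have ht := NU.t_lt (h.hole b) hP hN
  have hy := hP.hy
  refine h.spread hP ?_ (j0 := b) (by omega) (h.act_of hb c3 c4 c1 c2) ?_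
  · rintro j hj rfl
    rcases lt_trichotomy j b with hh | hh | hh
    · have := h.lt hh hb
      linarith
    · subst hh
      linarith
    · have := h.lt hh hj
      linarith
  · rw [ht_le hb]
    have := (h.hole b).yr_mem
    linarith

lemma Path.next {A : Arr ι} {u : ℕ → Q} {n : ℕ} (h : A.Path u n) {P P' : Q}
    (hP : A.IsHole P) (hP' : A.IsHole P') (hA : Above u n P) (hN : A.NU P P') :
    Above u n P' := by
  classical
  obtain ⟨c, c1, c2, c3, c4⟩ := NU.common hP hP' hN
  have htt := NU.t_lt hP hP' hN
  have hy := hP'.hy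
  have hex : ∃ j, j = n + 1 ∨ (j ≤ n ∧ (u j).l ≤ c) := ⟨n + 1, Or.inl rfl⟩
  set j0 := Nat.find hex with hj0
  have hs := Nat.find_spec hex
  rw [← hj0] at hs
  have hmin : ∀ k, k < j0 → ¬ (k = n + 1 ∨ (k ≤ n ∧ (u k).l ≤ c)) := fun k hk =>
    Nat.find_min hex hk
  have hle : j0 ≤ n + 1 := by omega
  have act : ∀ R : Q, R.l ≤ c → c ≤ R.r → Act u n j0 R := by
    intro R r1 r2
    refine ⟨fun hj => ?_, fun hj => ?_⟩
    · have h1 := hmin (j0 - 1) (by omega)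
      push Not at h1
      have h2 := h1.2 (by omega)
      have := (h.hole (j0 - 1)).hx
      linarith
    · rcases hs with hs | hs
      · omega
      · linarith [hs.2]
  have h1 := hA j0 hle (act P c1 c2)
  refine h.spread hP' ?_ hle (act P' c3 c4) (by linarith)
  rintro b hb rfl
  have h2 := hA b (by omega) (h.act_of hb c1 c2 c3 c4)
  rw [ht_le hb] at h2
  have := (h.hole b).yr_mem
  linarith

/-- `NL` on holes. -/
def HL (A : Arr ι) (a b : A.H) : Prop := A.NL a.1 b.1
/-- `NU` on holes. -/
def HU (A : Arr ι) (a b : A.H) : Prop := A.NU a.1 b.1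

lemma exists_path {A : Arr ι} {a b : A.H} (h : Relation.ReflTransGen A.HL a b) :
    ∃ n u, A.Path u n ∧ u 0 = a.1 ∧ u n = b.1 := by
  induction h with
  | refl => exact ⟨0, fun _ => a.1, ⟨fun _ => a.2, fun j hj => by omega⟩, rfl, rfl⟩
  | @tail b c hab hbc ih =>
    obtain ⟨n, u, hu, h0, hn⟩ := ih
    refine ⟨n + 1, fun j => if j ≤ n then u j else c.1, ⟨fun j => ?_, fun j hj => ?_⟩, ?_, ?_⟩
    · split_ifs
      · exact hu.hole j
      · exact c.2
    · rw [if_pos (by omega)]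
      split_ifs with h1
      · exact hu.step j (by omega)
      · have : j = n := by omega
        rw [this, hn]
        exact hbc
    · simp [h0]
    · simp

lemma Path.trans {A : Arr ι} {u : ℕ → Q} {n : ℕ} (h : A.Path u n) {b : ℕ} (hb : b ≤ n)
    {P P' : A.H} (hP : P.1 = u b) (hN : Relation.TransGen A.HU P P') : Above u n P'.1 := by
  induction hN with
  | single h1 =>
    unfold HU at h1
    rw [hP] at h1
    exact h.base hb (Subtype.prop _) h1
  | tail h1 h2 ih => exact h.next (Subtype.prop _) (Subtype.prop _) ih h2

lemma no_both {A : Arr ι} {a b : A.H} (hne : a ≠ b)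
    (h1 : Relation.ReflTransGen A.HL a b ∨ Relation.ReflTransGen A.HL b a)
    (h2 : Relation.ReflTransGen A.HU a b ∨ Relation.ReflTransGen A.HU b a) : False := by
  wlog h : Relation.ReflTransGen A.HL a b generalizing a b
  · exact this hne.symm h1.symm h2.symm (h1.resolve_left h)
  obtain ⟨n, u, hu, h0, hn⟩ := exists_path h
  rcases h2 with h2 | h2
  · rcases Relation.reflTransGen_iff_eq_or_transGen.1 h2 with h3 | h3
    · exact hne h3.symm
    · have := hu.trans (b := 0) (by omega) h0.symm h3
      rw [← hn] at this
      exact hu.not_above le_rfl this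
  · rcases Relation.reflTransGen_iff_eq_or_transGen.1 h2 with h3 | h3
    · exact hne h3
    · have := hu.trans (b := n) (by omega) hn.symm h3
      rw [← h0] at this
      exact hu.not_above (Nat.zero_le _) this

lemma reach_terminal {α : Type*} [Finite α] (r : α → α → Prop) (f : α → ℝ)
    (hf : ∀ a b, r a b → f b < f a) (a : α) :
    ∃ b, Relation.ReflTransGen r a b ∧ ∀ c, ¬ r b c := by
  obtain ⟨b, hb, hmin⟩ := Set.exists_min_image {b | Relation.ReflTransGen r a b} f
    (Set.toFinite _) ⟨a, Relation.ReflTransGen.refl⟩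
  refine ⟨b, hb, fun c hc => ?_⟩
  have h1 := hmin c (Relation.ReflTransGen.tail hb hc)
  have h2 := hf b c hc
  linarith

lemma total_of_left {α : Type*} {r : α → α → Prop} (hr : ∀ a b c, r a c → r b c → a = b)
    {a b c : α} (h1 : Relation.ReflTransGen r a c) (h2 : Relation.ReflTransGen r b c) :
    Relation.ReflTransGen r a b ∨ Relation.ReflTransGen r b a := by
  have h := Relation.ReflTransGen.total_of_right_unique (r := Function.swap r)
    (fun x y z h1 h2 => hr _ _ _ h1 h2) (Relation.reflTransGen_swap.2 h1)
    (Relation.reflTransGen_swap.2 h2)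
  exact h.symm.imp Relation.reflTransGen_swap.1 Relation.reflTransGen_swap.1

lemma Q.anti_inj {p q : Q} (h : p.anti = q.anti) : p = q := by
  rw [← p.anti_anti, h, q.anti_anti]

lemma Q.anti_tlx (q : Q) : q.anti.tlx = -q.yr := by
  unfold Q.tlx Q.yr Q.anti
  cases q.s <;> simp

lemma Q.anti_yr (q : Q) : q.anti.yr = -q.tlx := by
  unfold Q.tlx Q.yr Q.anti
  cases q.s <;> simp

/-- Holes with no hole to the left. -/
abbrev TermL (A : Arr ι) : Type := {a : A.H // ∀ b, ¬ A.HL a b}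
/-- Holes with no hole above. -/
abbrev TermU (A : Arr ι) : Type := {a : A.H // ∀ b, ¬ A.HU a b}
/-- Rectangles whose top left corner lies in the frame. -/
abbrev Inner (A : Arr ι) : Type :=
  {i : ι // A.cl ≤ A.l i ∧ A.l i < A.cr ∧ A.cb < A.t i ∧ A.t i ≤ A.ct}

lemma finite_H [Finite ι] (A : Arr ι) : Finite A.H := by
  choose g h1 h2 using fun a : A.H => a.2.exists_tl
  refine Finite.of_injective g (fun a b hab => Subtype.ext (IsHole.tl_inj a.2 b.2 ?_ ?_))
  · rw [← h1, ← h1, hab]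
  · rw [← h2, ← h2, hab]

lemma card_le_mul [Finite ι] (A : Arr ι) :
    Nat.card A.H ≤ Nat.card A.TermL * Nat.card A.TermU := by
  have := A.finite_H
  choose f hf1 hf2 using reach_terminal A.HL (fun a => a.1.l) (fun a b h => by
    have := NL.r_lt a.2 b.2 h
    have := b.2.hx
    linarith)
  choose g hg1 hg2 using reach_terminal A.HU (fun a => -a.1.t) (fun a b h => by
    have := NU.t_lt a.2 b.2 h
    have := b.2.hy
    linarith)
  rw [← Nat.card_prod]
  refine Nat.card_le_card_of_injective
    (fun a => ((⟨f a, hf2 a⟩ : A.TermL), (⟨g a, hg2 a⟩ : A.TermU))) ?_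
  intro a b hab
  simp only [Prod.mk.injEq, Subtype.mk.injEq] at hab
  by_contra hne
  refine no_both hne (total_of_left ?_ (hf1 a) (hab.1 ▸ hf1 b))
    (total_of_left ?_ (hg1 a) (hab.2 ▸ hg1 b))
  · intro a b c h1 h2
    exact Subtype.ext (NL.inj a.2 b.2 h1 h2)
  · intro a b c h1 h2
    exact Subtype.ext (Q.anti_inj (NL.inj a.2.anti b.2.anti h1 h2))

lemma card_add_le [Finite ι] (A : Arr ι) (hA : A.Inside) (hx : A.cl < A.cr) (hy : A.cb < A.ct) :
    1 + Nat.card A.H + Nat.card A.TermL + Nat.card A.TermU ≤ Nat.card A.Inner := by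
  have := A.finite_H
  choose eL hL using fun a : A.H => a.2.exists_exit hA
  choose eU hU using fun a : A.H => a.2.anti.exists_exit hA.anti
  let F : (Unit ⊕ A.H) ⊕ (A.TermL ⊕ A.TermU) → ℝ × ℝ := fun z => match z with
    | Sum.inl (Sum.inl _) => (A.cl, A.ct)
    | Sum.inl (Sum.inr a) => (a.1.tlx, a.1.yr)
    | Sum.inr (Sum.inl a) => (eL a.1, a.1.1.yl)
    | Sum.inr (Sum.inr a) => (-a.1.1.anti.yl, -eU a.1)
  have tlm : ∀ a : A.H, a.1.l ≤ a.1.tlx ∧ a.1.tlx ≤ a.1.r := fun a => by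
    have := a.2.hx
    unfold Q.tlx
    split_ifs <;> constructor <;> linarith
  have ylm : ∀ a : A.H, a.1.l ≤ -a.1.anti.yl ∧ -a.1.anti.yl ≤ a.1.r := fun a => by
    have h := a.2.anti.yl_mem
    simp only [Q.anti] at h ⊢
    constructor <;> linarith
  have hex : ∀ z, ∃ i : A.Inner, A.l i.1 = (F z).1 ∧ A.t i.1 = (F z).2 := by
    have mk : ∀ x y : ℝ, A.cl ≤ x → x < A.cr → A.cb < y → y ≤ A.ct →
        (∃ i, A.l i = x ∧ A.t i = y) → ∃ i : A.Inner, A.l i.1 = x ∧ A.t i.1 = y := by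
      rintro x y h1 h2 h3 h4 ⟨i, rfl, rfl⟩
      exact ⟨⟨i, h1, h2, h3, h4⟩, rfl, rfl⟩
    rintro ((_ | a) | (a | a))
    · refine mk _ _ le_rfl hx hy le_rfl ?_
      rcases A.quadrant le_rfl hx hy le_rfl with ⟨i, h1, h2, h3, h4⟩ | ⟨q, hq, h1, h2, h3, h4⟩
      · refine ⟨i, le_antisymm h1 ?_, le_antisymm ?_ h4⟩
        · by_contra hh
          obtain ⟨w, w1, w2, w3⟩ := A.wallL
          have := A.hlr w
          have := A.eq_of_overlap (i := i) (j := w) (by linarith) (by linarith) (by linarith)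
            (by linarith)
          subst this
          linarith
        · by_contra hh
          obtain ⟨w, w1, w2, w3⟩ := A.wallT
          have := A.hbt w
          have := A.eq_of_overlap (i := i) (j := w) (by linarith) (by linarith) (by linarith)
            (by linarith)
          subst this
          linarith
      · have := (hA q hq).1
        linarith
    · obtain ⟨h1, h2, h3, h4⟩ := hA _ a.2
      have h5 := tlm a
      have h6 := a.2.yr_mem
      have := a.2.hy
      exact mk _ _ (by linarith) (by linarith) (by linarith) (by linarith) a.2.exists_tl
    · obtain ⟨h1, h2, h3, h4⟩ := hA _ a.1.2
      have h5 := hL a.1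
      have h6 := a.1.2.yl_mem
      have h7 := h5.lt
      have := a.1.2.hx
      have := a.1.2.hy
      refine mk _ _ h5.cl (by linarith) (by linarith) (by linarith) ?_
      rcases h5.dich hA a.1.2 with ⟨q', hq', h8⟩ | h8
      · exact (a.2 ⟨q', hq'⟩ h8).elim
      · exact h8
    · obtain ⟨h1, h2, h3, h4⟩ := hA _ a.1.2
      have h5 := hU a.1
      have h6 := ylm a.1
      have h7 := h5.lt
      have h9 := h5.cl
      have := a.1.2.hx
      have := a.1.2.hy
      have e1 : A.anti.cl = -A.ct := rfl
      have e2 : a.1.1.anti.l = -a.1.1.t := rfl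
      refine mk _ _ (by linarith) (by linarith) (by linarith) (by linarith) ?_
      rcases h5.dich hA.anti a.1.2.anti with ⟨q', hq', h8⟩ | ⟨i, h8, h10⟩
      · refine (a.2 ⟨q'.anti, hq'.of_anti⟩ ?_).elim
        unfold HU NU
        simp only
        rw [Q.anti_anti]
        exact h8
      · have e3 : A.anti.l i = -A.t i := rfl
        have e4 : A.anti.t i = -A.l i := rfl
        exact ⟨i, by linarith, by linarith⟩
  have cH : ∀ a : A.H, (A.cl, A.ct) ≠ (a.1.tlx, a.1.yr) := fun a h => by
    simp only [Prod.mk.injEq] at h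
    have := (hA _ a.2).1
    have := tlm a
    linarith [h.1]
  have cL : ∀ a : A.H, (A.cl, A.ct) ≠ (eL a, a.1.yl) := fun a h => by
    simp only [Prod.mk.injEq] at h
    have := (hA _ a.2).2.2.2
    have := a.2.yl_mem
    linarith [h.2]
  have cU : ∀ a : A.H, (A.cl, A.ct) ≠ (-a.1.anti.yl, -eU a) := fun a h => by
    simp only [Prod.mk.injEq] at h
    have := (hA _ a.2).1
    have := ylm a
    linarith [h.1]
  have HL' : ∀ (p : A.H) (q : A.TermL), (p.1.tlx, p.1.yr) ≠ (eL q.1, q.1.1.yl) := fun p q h => by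
    simp only [Prod.mk.injEq] at h
    exact q.2 p ((hL q.1).ne_tl p.2 h.1.symm h.2.symm)
  have HU' : ∀ (p : A.H) (q : A.TermU), (p.1.tlx, p.1.yr) ≠ (-q.1.1.anti.yl, -eU q.1) :=
    fun p q h => by
      simp only [Prod.mk.injEq] at h
      refine q.2 p ((hU q.1).ne_tl p.2.anti ?_ ?_)
      · rw [Q.anti_tlx]; linarith [h.2]
      · rw [Q.anti_yr]; linarith [h.1]
  have LU : ∀ (p q : A.H), (eL p, p.1.yl) ≠ (-q.1.anti.yl, -eU q) := fun p q h => by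
    simp only [Prod.mk.injEq] at h
    obtain ⟨S, s1, s2, s3⟩ := (hL p).str
    obtain ⟨S', s1', s2', s3'⟩ := (hU q).str
    have e1 : A.anti.r S' = -A.b S' := rfl
    have e2 : A.anti.b S' = -A.r S' := rfl
    have e3 : A.anti.t S' = -A.l S' := rfl
    have := A.hlr S
    have := A.hbt S'
    have := A.eq_of_overlap (i := S) (j := S') (by linarith) (by linarith) (by linarith)
      (by linarith)
    subst this
    linarith
  have hF : Function.Injective F := by
    rintro ((_ | a) | (a | a)) ((_ | b) | (b | b)) hab
    · rfl
    · exact (cH _ hab).elim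
    · exact (cL _ hab).elim
    · exact (cU _ hab).elim
    · exact (cH _ hab.symm).elim
    · simp only [F, Prod.mk.injEq] at hab
      congr 2
      exact Subtype.ext (IsHole.tl_inj a.2 b.2 hab.1 hab.2)
    · exact (HL' _ _ hab).elim
    · exact (HU' _ _ hab).elim
    · exact (cL _ hab.symm).elim
    · exact (HL' _ _ hab.symm).elim
    · simp only [F, Prod.mk.injEq] at hab
      congr 2
      refine Subtype.ext (Subtype.ext (Exit.inj a.1.2 b.1.2 (hL _) ?_ hab.2))
      rw [hab.1]; exact hL _
    · exact (LU _ _ hab).elim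
    · exact (cU _ hab.symm).elim
    · exact (HU' _ _ hab.symm).elim
    · exact (LU _ _ hab.symm).elim
    · simp only [F, Prod.mk.injEq, neg_inj] at hab
      congr 2
      refine Subtype.ext (Subtype.ext (Q.anti_inj
        (Exit.inj a.1.2.anti b.1.2.anti (hU _) ?_ hab.1)))
      rw [hab.2]; exact hU _
  choose g hg1 hg2 using hex
  have hg : Function.Injective g := fun a b hab => hF (Prod.ext
    (by rw [← hg1, ← hg1, hab]) (by rw [← hg2, ← hg2, hab]))
  have := Nat.card_le_card_of_injective g hg
  rw [Nat.card_sum, Nat.card_sum, Nat.card_sum, Nat.card_unique] at this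
  omega

lemma count [Finite ι] (A : Arr ι) (hA : A.Inside) (hx : A.cl < A.cr) (hy : A.cb < A.ct) {m : ℕ}
    (hm : Nat.card A.Inner ≤ m) : (Nat.card A.H : ℤ) ≤ (m : ℤ) - ⌈2 * Real.sqrt m - 1⌉ := by
  have h1 := A.card_le_mul
  have h2 := A.card_add_le hA hx hy
  generalize Nat.card A.H = h at *
  generalize Nat.card A.TermL = p at *
  generalize Nat.card A.TermU = q at *
  have h3 : ⌈2 * Real.sqrt m - 1⌉ ≤ (m : ℤ) - h := by
    rw [Int.ceil_le]
    push_cast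
    have h4 : (h : ℝ) ≤ p * q := by exact_mod_cast h1
    have h5 : 1 + (h : ℝ) + p + q ≤ m := by
      have : 1 + h + p + q ≤ m := h2.trans hm
      exact_mod_cast this
    have hp : (0 : ℝ) ≤ p := Nat.cast_nonneg _
    have hq : (0 : ℝ) ≤ q := Nat.cast_nonneg _
    have h6 : Real.sqrt m ≤ ((m : ℝ) - h + 1) / 2 := by
      apply Real.sqrt_le_iff.2
      constructor
      · linarith
      · have e : ∃ k : ℝ, (m : ℝ) = h + k ∧ p + q + 1 ≤ k := ⟨m - h, by ring, by linarith⟩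
        obtain ⟨k, e1, e2⟩ := e
        rw [e1]
        nlinarith [sq_nonneg ((p : ℝ) - q), mul_self_nonneg (k - 1 - p - q)]
    linarith
  omega

lemma raw_blk {m : ℕ} (l r b t : Fin m → ℝ) (cr : ℝ) (hlr : ∀ i, l i < r i)
    (disj : ∀ i j, i ≠ j → r i ≤ l j ∨ r j ≤ l i ∨ t i ≤ b j ∨ t j ≤ b i)
    (i : Fin m) (hi : r i < cr)
    (hmax : ∀ r', r i < r' → r' ≤ cr →
      ∃ j, j ≠ i ∧ l j < r' ∧ l i < r j ∧ b i < t j ∧ b j < t i) :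
    ∃ j, l j = r i ∧ b j < t i ∧ b i < t j := by
  have hev : ∀ᶠ e : ℝ in nhdsWithin (r i) (Set.Ioi (r i)), r i < e ∧ e < cr ∧
      ∀ j, (r i < l j → e < l j) := by
    have key : ∀ c : ℝ, r i < c → ∀ᶠ e : ℝ in nhdsWithin (r i) (Set.Ioi (r i)), e < c :=
      fun c hc => nhdsWithin_le_nhds (Iio_mem_nhds hc)
    refine Filter.Eventually.and self_mem_nhdsWithin ((key _ hi).and ?_)
    rw [Filter.eventually_all]
    intro j
    by_cases hh : r i < l j
    · filter_upwards [key (l j) hh] with e he _ using he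
    · simp [hh]
  obtain ⟨e, h1, h2, h3⟩ := hev.exists
  obtain ⟨j, j1, j2, j3, j4, j5⟩ := hmax e h1 h2.le
  refine ⟨j, le_antisymm ?_ ?_, j5, j4⟩
  · by_contra hh
    have := h3 j (by linarith)
    linarith
  · have := hlr i
    have := hlr j
    rcases disj i j j1.symm with h | h | h | h <;> linarith

/-- Raw data: a maximal arrangement in coordinates. -/
structure Raw (m : ℕ) where
  l : Fin m → ℝ
  r : Fin m → ℝ
  b : Fin m → ℝ
  t : Fin m → ℝ
  cl : ℝ
  cr : ℝ
  cb : ℝ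
  ct : ℝ
  hx : cl < cr
  hy : cb < ct
  hlr : ∀ i, l i < r i
  hbt : ∀ i, b i < t i
  hcl : ∀ i, cl ≤ l i
  hcr : ∀ i, r i ≤ cr
  hcb : ∀ i, cb ≤ b i
  hct : ∀ i, t i ≤ ct
  max : ∀ i l' r' b' t', l' ≤ l i → r i ≤ r' → b' ≤ b i → t i ≤ t' → cl ≤ l' → r' ≤ cr →
    cb ≤ b' → t' ≤ ct →
    (∀ j, j ≠ i → r' ≤ l j ∨ r j ≤ l' ∨ t' ≤ b j ∨ t j ≤ b') →
    l' = l i ∧ r' = r i ∧ b' = b i ∧ t' = t i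
  disj : ∀ i j, i ≠ j → r i ≤ l j ∨ r j ≤ l i ∨ t i ≤ b j ∨ t j ≤ b i

/-- The arrangement with four outer walls added: left, top, right, bottom. -/
noncomputable def Raw.arr {m : ℕ} (W : Raw m) : Arr (Fin m ⊕ Fin 4) where
  l := Sum.elim W.l ![W.cl - 1, W.cl, W.cr, W.cl - 1]
  r := Sum.elim W.r ![W.cl, W.cr + 1, W.cr + 1, W.cr]
  b := Sum.elim W.b ![W.cb, W.ct, W.cb - 1, W.cb - 1]
  t := Sum.elim W.t ![W.ct + 1, W.ct + 1, W.ct, W.cb]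
  cl := W.cl
  cr := W.cr
  cb := W.cb
  ct := W.ct
  hlr := by
    have := W.hx
    rintro (i | i)
    · exact W.hlr i
    · fin_cases i <;> simp <;> linarith
  hbt := by
    have := W.hy
    rintro (i | i)
    · exact W.hbt i
    · fin_cases i <;> simp <;> linarith
  disj := by
    have key : ∀ (i : Fin m) (j : Fin 4),
        (W.r i ≤ ![W.cl - 1, W.cl, W.cr, W.cl - 1] j) ∨
        (![W.cl, W.cr + 1, W.cr + 1, W.cr] j ≤ W.l i) ∨
        (W.t i ≤ ![W.cb, W.ct, W.cb - 1, W.cb - 1] j) ∨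
        (![W.ct + 1, W.ct + 1, W.ct, W.cb] j ≤ W.b i) := by
      intro i j
      have := W.hcl i
      have := W.hcr i
      have := W.hcb i
      have := W.hct i
      fin_cases j
      · right; left; simpa
      · right; right; left; simpa
      · left; simpa
      · right; right; right; simpa
    rintro (i | i) (j | j) hij
    · exact W.disj i j (fun h => hij (by rw [h]))
    · exact key i j
    · have := key j i
      simp only [Sum.elim_inl, Sum.elim_inr]
      tauto
    · have hx' := W.hx.le
      have hy' := W.hy.le
      fin_cases i <;> fin_cases j <;> first | exact (hij rfl).elim | skip
      all_goals simp [hx', hy']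
  blkR := by
    rintro (i | i) hi
    · obtain ⟨j, hj⟩ := raw_blk W.l W.r W.b W.t W.cr W.hlr W.disj i hi (by
        intro r' h1 h2
        by_contra hc
        push Not at hc
        have := W.hlr i
        have := W.max i (W.l i) r' (W.b i) (W.t i) le_rfl h1.le le_rfl le_rfl (W.hcl i) h2
          (W.hcb i) (W.hct i) (fun j hj => by
            by_contra hh
            push Not at hh
            have := hc j hj hh.1 hh.2.1 hh.2.2.2
            linarith [hh.2.2.1])
        linarith [this.2.1])
      exact ⟨Sum.inl j, hj⟩
    · have h1 := W.hx
      have h2 := W.hy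
      fin_cases i
      · refine ⟨Sum.inr 1, ?_⟩
        simp; linarith
      all_goals
        exfalso
        simp at hi
        try linarith
  blkL := by
    rintro (i | i) hi
    · obtain ⟨j, hj⟩ := raw_blk (fun i => -W.r i) (fun i => -W.l i) W.b W.t (-W.cl)
        (fun i => neg_lt_neg (W.hlr i)) (fun i j hij => by
          rcases W.disj i j hij with h | h | h | h
          · right; left; linarith
          · left; linarith
          · right; right; left; linarith
          · right; right; right; linarith) i (neg_lt_neg hi) (by
        intro r' h1 h2
        by_contra hc
        push Not at hc
        have := W.hlr i
        have := W.max i (-r') (W.r i) (W.b i) (W.t i) (by linarith) le_rfl le_rfl le_rfl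
          (by linarith) (W.hcr i) (W.hcb i) (W.hct i) (fun j hj => by
            by_contra hh
            push Not at hh
            have := hc j hj (by linarith) (by linarith) hh.2.2.2
            linarith [hh.2.2.1])
        linarith [this.1])
      exact ⟨Sum.inl j, neg_inj.1 hj.1, hj.2⟩
    · have h1 := W.hx
      have h2 := W.hy
      fin_cases i
      rotate_left 2
      · refine ⟨Sum.inr 3, ?_⟩
        simp; linarith
      all_goals
        exfalso
        simp at hi
        try linarith
  blkT := by
    rintro (i | i) hi
    · obtain ⟨j, hj⟩ := raw_blk W.b W.t W.l W.r W.ct W.hbt (fun i j hij => by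
          rcases W.disj i j hij with h | h | h | h
          · right; right; left; linarith
          · right; right; right; linarith
          · left; linarith
          · right; left; linarith) i hi (by
        intro r' h1 h2
        by_contra hc
        push Not at hc
        have := W.hbt i
        have := W.max i (W.l i) (W.r i) (W.b i) r' le_rfl le_rfl le_rfl h1.le (W.hcl i) (W.hcr i)
          (W.hcb i) h2 (fun j hj => by
            by_contra hh
            push Not at hh
            have := hc j hj hh.2.2.1 hh.2.2.2 hh.2.1
            linarith [hh.1])
        linarith [this.2.2.2])
      exact ⟨Sum.inl j, hj⟩
    · have h1 := W.hx
      have h2 := W.hy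
      fin_cases i
      rotate_left 3
      · refine ⟨Sum.inr 0, ?_⟩
        simp; linarith
      all_goals
        exfalso
        simp at hi
        try linarith
  blkB := by
    rintro (i | i) hi
    · obtain ⟨j, hj⟩ := raw_blk (fun i => -W.t i) (fun i => -W.b i) W.l W.r (-W.cb)
        (fun i => neg_lt_neg (W.hbt i)) (fun i j hij => by
          rcases W.disj i j hij with h | h | h | h
          · right; right; left; linarith
          · right; right; right; linarith
          · right; left; linarith
          · left; linarith) i (neg_lt_neg hi) (by
        intro r' h1 h2
        by_contra hc
        push Not at hc
        have := W.hbt i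
        have := W.max i (W.l i) (W.r i) (-r') (W.t i) le_rfl le_rfl (by linarith) le_rfl
          (W.hcl i) (W.hcr i) (by linarith) (W.hct i) (fun j hj => by
            by_contra hh
            push Not at hh
            have := hc j hj (by linarith) (by linarith) hh.2.1
            linarith [hh.1])
        linarith [this.2.2.1])
      exact ⟨Sum.inl j, neg_inj.1 hj.1, hj.2⟩
    · have h1 := W.hx
      have h2 := W.hy
      fin_cases i
      rotate_left 1
      · refine ⟨Sum.inr 2, ?_⟩
        simp; linarith
      all_goals
        exfalso
        simp at hi
        try linarith
  wallL := ⟨Sum.inr 0, by simp⟩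
  wallR := ⟨Sum.inr 2, by simp⟩
  wallB := ⟨Sum.inr 3, by simp⟩
  wallT := ⟨Sum.inr 1, by simp⟩

lemma Raw.eqL {m : ℕ} (W : Raw m) {x : Fin m ⊕ Fin 4} (h : W.arr.r x = W.cl) : x = Sum.inr 0 := by
  have h1 := W.hx
  rcases x with i | i
  · have := W.hlr i
    have := W.hcl i
    have e : W.r i = W.cl := h
    linarith
  · fin_cases i <;> simp [Raw.arr] at h ⊢ <;> linarith

lemma Raw.eqR {m : ℕ} (W : Raw m) {x : Fin m ⊕ Fin 4} (h : W.arr.l x = W.cr) : x = Sum.inr 2 := by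
  have h1 := W.hx
  rcases x with i | i
  · have := W.hlr i
    have := W.hcr i
    have e : W.l i = W.cr := h
    linarith
  · fin_cases i <;> simp [Raw.arr] at h ⊢ <;> linarith

lemma Raw.eqB {m : ℕ} (W : Raw m) {x : Fin m ⊕ Fin 4} (h : W.arr.t x = W.cb) : x = Sum.inr 3 := by
  have h1 := W.hy
  rcases x with i | i
  · have := W.hbt i
    have := W.hcb i
    have e : W.t i = W.cb := h
    linarith
  · fin_cases i <;> simp [Raw.arr] at h ⊢ <;> linarith

lemma Raw.eqT {m : ℕ} (W : Raw m) {x : Fin m ⊕ Fin 4} (h : W.arr.b x = W.ct) : x = Sum.inr 1 := by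
  have h1 := W.hy
  rcases x with i | i
  · have := W.hbt i
    have := W.hct i
    have e : W.b i = W.ct := h
    linarith
  · fin_cases i <;> simp [Raw.arr] at h ⊢ <;> linarith

lemma Raw.inside {m : ℕ} (W : Raw m) (hm : 1 ≤ m) : W.arr.Inside := by
  intro q hq
  have hx := hq.hx
  have hy := hq.hy
  have g1 : W.cl ≤ q.l := hq.cl
  have g2 : q.r ≤ W.cr := hq.cr
  have g3 : W.cb ≤ q.b := hq.cb
  have g4 : q.t ≤ W.ct := hq.ct
  change W.cl < q.l ∧ q.r < W.cr ∧ W.cb < q.b ∧ q.t < W.ct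
  have full : q.l = W.cl → q.r = W.cr → q.b = W.cb → q.t = W.ct → False := by
    intro e1 e2 e3 e4
    let i : Fin m := ⟨0, hm⟩
    have := W.hlr i
    have := W.hbt i
    have := W.hcl i
    have := W.hcr i
    have := W.hcb i
    have := W.hct i
    have h : q.r ≤ W.l i ∨ W.r i ≤ q.l ∨ q.t ≤ W.b i ∨ W.t i ≤ q.b := hq.emp (Sum.inl i)
    rcases h with h | h | h | h <;> linarith
  obtain ⟨L, R, B, T, ⟨-, hp⟩ | ⟨-, hp⟩⟩ := hq.pin
  · obtain ⟨⟨a1, a2, a3⟩, ⟨b1, b2, b3⟩, ⟨c1, c2, c3⟩, ⟨d1, d2, d3⟩⟩ := hp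
    have f1 : q.l = W.cl → q.b = W.cb := by
      intro e
      have := W.eqL (a1.trans e)
      subst this
      rw [← a2]; simp [Raw.arr]
    have f2 : q.b = W.cb → q.r = W.cr := by
      intro e
      have := W.eqB (c1.trans e)
      subst this
      rw [← c2]; simp [Raw.arr]
    have f3 : q.r = W.cr → q.t = W.ct := by
      intro e
      have := W.eqR (b1.trans e)
      subst this
      rw [← b2]; simp [Raw.arr]
    have f4 : q.t = W.ct → q.l = W.cl := by
      intro e
      have := W.eqT (d1.trans e)
      subst this
      rw [← d2]; simp [Raw.arr]
    refine ⟨lt_of_le_of_ne g1 ?_, lt_of_le_of_ne g2 ?_, lt_of_le_of_ne g3 ?_,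
      lt_of_le_of_ne g4 ?_⟩ <;> intro e
    · have e := e.symm
      exact full e (f2 (f1 e)) (f1 e) (f3 (f2 (f1 e)))
    · exact full (f4 (f3 e)) e (f1 (f4 (f3 e))) (f3 e)
    · have e := e.symm
      exact full (f4 (f3 (f2 e))) (f2 e) e (f3 (f2 e))
    · exact full (f4 e) (f2 (f1 (f4 e))) (f1 (f4 e)) e
  · obtain ⟨⟨a1, a2, a3⟩, ⟨b1, b2, b3⟩, ⟨c1, c2, c3⟩, ⟨d1, d2, d3⟩⟩ := hp
    refine ⟨lt_of_le_of_ne g1 ?_, lt_of_le_of_ne g2 ?_, lt_of_le_of_ne g3 ?_,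
      lt_of_le_of_ne g4 ?_⟩ <;> intro e
    · have := W.eqL (a1.trans e.symm)
      subst this
      simp [Raw.arr] at a2
      linarith
    · have := W.eqR (b1.trans e)
      subst this
      simp [Raw.arr] at b2
      linarith
    · have := W.eqB (c1.trans e.symm)
      subst this
      simp [Raw.arr] at c2
      linarith
    · have := W.eqT (d1.trans e)
      subst this
      simp [Raw.arr] at d2
      linarith

lemma Raw.card_inner {m : ℕ} (W : Raw m) : Nat.card W.arr.Inner ≤ m := by
  have h : ∀ x : W.arr.Inner, ∃ j : Fin m, x.1 = Sum.inl j := by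
    rintro ⟨x, h1, h2, h3, h4⟩
    rcases x with i | i
    · exact ⟨i, rfl⟩
    · exfalso
      fin_cases i <;> simp [Raw.arr] at h1 h2 h3 h4 <;> linarith
  choose g hg using h
  have := Nat.card_le_card_of_injective g (fun a b hab => Subtype.ext (by rw [hg, hg, hab]))
  simpa using this

lemma Raw.inner_of_mem {m : ℕ} (W : Raw m) {i : Fin m ⊕ Fin 4} {x y : ℝ} (h1 : W.cl < x)
    (h2 : x < W.cr) (h3 : W.cb < y) (h4 : y < W.ct) (g1 : W.arr.l i ≤ x) (g2 : x ≤ W.arr.r i)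
    (g3 : W.arr.b i ≤ y) (g4 : y ≤ W.arr.t i) : ∃ j, i = Sum.inl j := by
  rcases i with i | i
  · exact ⟨i, rfl⟩
  · exfalso
    fin_cases i <;> simp [Raw.arr] at g1 g2 g3 g4 <;> linarith

/-- The open box of a hole. -/
def Q.box (q : Q) : Set (ℝ × ℝ) := Set.Ioo q.l q.r ×ˢ Set.Ioo q.b q.t

/-- The free region. -/
def Raw.free {m : ℕ} (W : Raw m) : Set (ℝ × ℝ) :=
  (Set.Ioo W.cl W.cr ×ˢ Set.Ioo W.cb W.ct) \
    ⋃ i, Set.Icc (W.l i) (W.r i) ×ˢ Set.Icc (W.b i) (W.t i)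

lemma Raw.not_mem_rect {m : ℕ} (W : Raw m) {p : ℝ × ℝ} (hp : p ∈ W.free) (i : Fin m ⊕ Fin 4)
    (g1 : W.arr.l i ≤ p.1) (g2 : p.1 ≤ W.arr.r i)
    (g3 : W.arr.b i ≤ p.2) (g4 : p.2 ≤ W.arr.t i) : False := by
  obtain ⟨⟨⟨h1, h2⟩, ⟨h3, h4⟩⟩, h5⟩ := hp
  obtain ⟨j, rfl⟩ := W.inner_of_mem h1 h2 h3 h4 g1 g2 g3 g4
  exact h5 (Set.mem_iUnion.2 ⟨j, ⟨g1, g2⟩, ⟨g3, g4⟩⟩)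

lemma Raw.closed_mem {m : ℕ} (W : Raw m) {p : ℝ × ℝ} (hp : p ∈ W.free) {q : Q}
    (hq : W.arr.IsHole q) (h1 : q.l ≤ p.1) (h2 : p.1 ≤ q.r) (h3 : q.b ≤ p.2) (h4 : p.2 ≤ q.t) :
    p ∈ q.box := by
  obtain ⟨L, R, B, T, ⟨a1, a2, a3⟩, ⟨b1, b2, b3⟩, ⟨c1, c2, c3⟩, ⟨d1, d2, d3⟩⟩ := hq.nbr
  have := W.arr.hlr L
  have := W.arr.hlr R
  have := W.arr.hbt B
  have := W.arr.hbt T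
  refine ⟨⟨lt_of_le_of_ne h1 ?_, lt_of_le_of_ne h2 ?_⟩, ⟨lt_of_le_of_ne h3 ?_,
    lt_of_le_of_ne h4 ?_⟩⟩ <;> intro e
  · exact W.not_mem_rect hp L (by linarith) (by linarith) (by linarith) (by linarith)
  · exact W.not_mem_rect hp R (by linarith) (by linarith) (by linarith) (by linarith)
  · exact W.not_mem_rect hp B (by linarith) (by linarith) (by linarith) (by linarith)
  · exact W.not_mem_rect hp T (by linarith) (by linarith) (by linarith) (by linarith)

lemma Raw.exists_hole {m : ℕ} (W : Raw m) {p : ℝ × ℝ} (hp : p ∈ W.free) :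
    ∃ q, W.arr.IsHole q ∧ p ∈ q.box := by
  have hp' := hp
  obtain ⟨⟨⟨h1, h2⟩, ⟨h3, h4⟩⟩, h5⟩ := hp'
  rcases W.arr.quadrant (x := p.1) (y := p.2) h1.le h2 h3 h4.le with
    ⟨i, g1, g2, g3, g4⟩ | ⟨q, hq, g1, g2, g3, g4⟩
  · exact (W.not_mem_rect hp i g1 g2.le g3.le g4).elim
  · exact ⟨q, hq, W.closed_mem hp hq g1 g2.le g3.le g4⟩

lemma Raw.component {m : ℕ} (W : Raw m) {p : ℝ × ℝ} (hp : p ∈ W.free) {q : Q}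
    (hq : W.arr.IsHole q) (hpq : p ∈ q.box) : connectedComponentIn W.free p = q.box := by
  have hsub : q.box ⊆ W.free := by
    rintro z ⟨⟨z1, z2⟩, ⟨z3, z4⟩⟩
    have g1 : W.cl ≤ q.l := hq.cl
    have g2 : q.r ≤ W.cr := hq.cr
    have g3 : W.cb ≤ q.b := hq.cb
    have g4 : q.t ≤ W.ct := hq.ct
    refine ⟨⟨⟨by linarith, by linarith⟩, ⟨by linarith, by linarith⟩⟩, fun hz => ?_⟩
    obtain ⟨i, ⟨i1, i2⟩, ⟨i3, i4⟩⟩ := Set.mem_iUnion.1 hz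
    have h : q.r ≤ W.l i ∨ W.r i ≤ q.l ∨ q.t ≤ W.b i ∨ W.t i ≤ q.b := hq.emp (Sum.inl i)
    rcases h with h | h | h | h <;> linarith
  apply Set.Subset.antisymm
  · refine isPreconnected_connectedComponentIn.subset_of_closure_inter_subset
      (isOpen_Ioo.prod isOpen_Ioo) ⟨p, mem_connectedComponentIn hp, hpq⟩ ?_
    rintro z ⟨z1, z2⟩
    have z3 := connectedComponentIn_subset _ _ z2
    rw [Q.box, closure_prod_eq, closure_Ioo hq.hx.ne, closure_Ioo hq.hy.ne] at z1
    exact W.closed_mem z3 hq z1.1.1 z1.1.2 z1.2.1 z1.2.2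
  · exact (((convex_Ioo _ _).prod (convex_Ioo _ _)).isPreconnected).subset_connectedComponentIn
      hpq hsub

lemma Raw.main {m : ℕ} (W : Raw m) (hm : 1 ≤ m) :
    ({K : Set (ℝ × ℝ) | ∃ x ∈ W.free, K = connectedComponentIn W.free x}).Finite ∧
    (({K : Set (ℝ × ℝ) | ∃ x ∈ W.free, K = connectedComponentIn W.free x}).ncard : ℤ) ≤
      (m : ℤ) - ⌈2 * Real.sqrt m - 1⌉ := by
  have := W.arr.finite_H
  have hsub : {K : Set (ℝ × ℝ) | ∃ x ∈ W.free, K = connectedComponentIn W.free x} ⊆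
      Set.range (fun a : W.arr.H => a.1.box) := by
    rintro K ⟨x, hx, rfl⟩
    obtain ⟨q, hq, hxq⟩ := W.exists_hole hx
    exact ⟨⟨q, hq⟩, (W.component hx hq hxq).symm⟩
  have hfin := Set.finite_range (fun a : W.arr.H => a.1.box)
  refine ⟨hfin.subset hsub, ?_⟩
  have h1 := Set.ncard_le_ncard hsub hfin
  have h2 := Finite.card_range_le (fun a : W.arr.H => a.1.box)
  rw [Nat.card_coe_set_eq] at h2
  have h3 := W.arr.count (W.inside hm) W.hx W.hy W.card_inner
  omega

lemma disj_iff {a b c d a' b' c' d' : ℝ} (h1 : a < b) (h2 : c < d) (h3 : a' < b') (h4 : c' < d') :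
    Disjoint (interior (Set.Icc a b ×ˢ Set.Icc c d)) (interior (Set.Icc a' b' ×ˢ Set.Icc c' d')) ↔
      b ≤ a' ∨ b' ≤ a ∨ d ≤ c' ∨ d' ≤ c := by
  simp only [interior_prod_eq, interior_Icc, Set.disjoint_prod, Set.Ioo_disjoint_Ioo, min_le_iff,
    le_max_iff]
  constructor
  · rintro (((h | h) | (h | h)) | ((h | h) | (h | h)))
    all_goals first | linarith | tauto
  · tauto

lemma sub_coord {a b c d a' b' c' d' : ℝ} (h1 : a < b) (h2 : c < d)
    (h : Set.Icc a b ×ˢ Set.Icc c d ⊆ Set.Icc a' b' ×ˢ Set.Icc c' d') :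
    a' ≤ a ∧ b ≤ b' ∧ c' ≤ c ∧ d ≤ d' := by
  have e1 := h (show (a, c) ∈ _ from ⟨⟨le_rfl, h1.le⟩, ⟨le_rfl, h2.le⟩⟩)
  have e2 := h (show (b, d) ∈ _ from ⟨⟨h1.le, le_rfl⟩, ⟨h2.le, le_rfl⟩⟩)
  exact ⟨e1.1.1, e2.1.2, e1.2.1, e2.2.2⟩

end Arr

theorem maximal_rect_arrangement_hole_count (C : Set (ℝ × ℝ)) (hC : IsRect C)
    (m : ℕ) (hm : 1 ≤ m) (Z : Fin m → Set (ℝ × ℝ)) (hZ : ∀ i, IsRect (Z i))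
    (hZC : ∀ i, Z i ⊆ C)
    (hdisj : ∀ i j, i ≠ j → Disjoint (interior (Z i)) (interior (Z j)))
    (hmax : ∀ i, ∀ R : Set (ℝ × ℝ), IsRect R → Z i ⊆ R → R ⊆ C →
      (∀ j, j ≠ i → Disjoint (interior R) (interior (Z j))) → R = Z i) :
    ({H : Set (ℝ × ℝ) | ∃ x ∈ interior C \ ⋃ i, Z i,
        H = connectedComponentIn (interior C \ ⋃ i, Z i) x}).Finite ∧
    (({H : Set (ℝ × ℝ) | ∃ x ∈ interior C \ ⋃ i, Z i,
        H = connectedComponentIn (interior C \ ⋃ i, Z i) x}).ncard : ℤ) ≤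
      (m : ℤ) - ⌈2 * Real.sqrt m - 1⌉ := by
  obtain ⟨cl, cr, cb, ct, hx, hy, rfl⟩ := hC
  choose l r b t hlr hbt hZe using hZ
  obtain rfl : Z = fun i => Set.Icc (l i) (r i) ×ˢ Set.Icc (b i) (t i) := funext hZe
  have hsub := fun i => Arr.sub_coord (hlr i) (hbt i) (hZC i)
  let W : Arr.Raw m :=
    { l := l, r := r, b := b, t := t, cl := cl, cr := cr, cb := cb, ct := ct
      hx := hx, hy := hy, hlr := hlr, hbt := hbt
      hcl := fun i => (hsub i).1
      hcr := fun i => (hsub i).2.1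
      hcb := fun i => (hsub i).2.2.1
      hct := fun i => (hsub i).2.2.2
      disj := fun i j hij => (Arr.disj_iff (hlr i) (hbt i) (hlr j) (hbt j)).1 (hdisj i j hij)
      max := by
        intro i l' r' b' t' h1 h2 h3 h4 h5 h6 h7 h8 h9
        have e1 := hlr i
        have e2 := hbt i
        have e3 : l' < r' := by linarith
        have e4 : b' < t' := by linarith
        have he := hmax i (Set.Icc l' r' ×ˢ Set.Icc b' t') ⟨l', r', b', t', e3, e4, rfl⟩
          (Set.prod_mono (Set.Icc_subset_Icc h1 h2) (Set.Icc_subset_Icc h3 h4))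
          (Set.prod_mono (Set.Icc_subset_Icc h5 h6) (Set.Icc_subset_Icc h7 h8))
          (fun j hj => (Arr.disj_iff e3 e4 (hlr j) (hbt j)).2 (h9 j hj))
        obtain ⟨f1, f2, f3, f4⟩ := Arr.sub_coord e3 e4 he.subset
        exact ⟨le_antisymm h1 f1, le_antisymm f2 h2, le_antisymm h3 f3, le_antisymm f4 h4⟩ }
  have hfree : interior (Set.Icc cl cr ×ˢ Set.Icc cb ct) \
      ⋃ i, Set.Icc (l i) (r i) ×ˢ Set.Icc (b i) (t i) = W.free := by
    rw [interior_prod_eq, interior_Icc, interior_Icc]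
    rfl
  have := W.main hm
  rw [← hfree] at this
  exact this
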